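/- arXiv:0911.4370 — 9 statements merged into one kernel-verified Lean document; each statement's English description precedes it below -/
import Mathlib

section
/- Let q be an odd prime power. Every set Ω of q+2 points in the projective plane PG(2,q) has at most two internal nuclei. -/
/-- A point of `PG(2,q)`: a 1-dimensional linear subspace of `F³`. -/
abbrev ProjPoint (F : Type*) [Field F] :=
  {W : Submodule F (Fin 3 → F) // Module.finrank F W = 1}

/-- A line of `PG(2,q)`: a 2-dimensional linear subspace of `F³`. -/
abbrev ProjLine (F : Type*) [Field F] :=
  {W : Submodule F (Fin 3 → F) // Module.finrank F W = 2}

/-- `P` is an internal nucleus of `Ω` if `P ∈ Ω` and every line through `P`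
meets `Ω` in exactly one point other than `P`. -/
def IsInternalNucleus {F : Type*} [Field F] (Ω : Set (ProjPoint F)) (P : ProjPoint F) : Prop :=
  P ∈ Ω ∧ ∀ L : ProjLine F, P.1 ≤ L.1 →
    ∃! Q : ProjPoint F, Q ∈ Ω ∧ Q ≠ P ∧ Q.1 ≤ L.1

lemma pp_rep {F : Type*} [Field F] (Q : ProjPoint F) :
    ∃ u : Fin 3 → F, u ≠ 0 ∧ Q.1 = Submodule.span F {u} := by
  obtain ⟨u, hu, hu0⟩ := (Submodule.ne_bot_iff Q.1).1 (by
    intro h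
    have := Q.2
    rw [h] at this
    simp at this)
  refine ⟨u, hu0, ?_⟩
  symm
  apply Submodule.eq_of_le_of_finrank_eq
  · simpa using hu
  · rw [finrank_span_singleton hu0, Q.2]

lemma ker_two {F : Type*} [Field F] (f : (Fin 3 → F) →ₗ[F] F) (hf : f ≠ 0) :
    Module.finrank F (LinearMap.ker f) = 2 := by
  have h := LinearMap.finrank_range_add_finrank_ker f
  have h2 : LinearMap.range f = ⊤ := LinearMap.range_eq_top.2 (LinearMap.surjective hf)
  rw [h2] at h
  simp at h
  omega

lemma notmem_side {F : Type*} [Field F] (Ω : Set (ProjPoint F)) (P P' Q : ProjPoint F)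
    (hP : IsInternalNucleus Ω P) (hP' : P' ∈ Ω) (hne : P' ≠ P) (L : ProjLine F)
    (h1 : P.1 ≤ L.1) (h2 : P'.1 ≤ L.1) (hQ : Q ∈ Ω) (hQP : Q ≠ P) (hQP' : Q ≠ P') :
    ¬ Q.1 ≤ L.1 := by
  intro h
  obtain ⟨R, -, hR⟩ := hP.2 L h1
  exact hQP' ((hR Q ⟨hQ, hQP, h⟩).trans (hR P' ⟨hP', hne, h2⟩).symm)

lemma prod_ratio {F : Type*} [Field F] [Fintype F] (Ω : Set (ProjPoint F))
    (P P' P'' : ProjPoint F) (u : ProjPoint F → (Fin 3 → F))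
    (hu : ∀ Q, Q.1 = Submodule.span F {u Q})
    (hP : IsInternalNucleus Ω P) (f g : (Fin 3 → F) →ₗ[F] F)
    (hfP : f (u P) = 0) (hgP : g (u P) = 0)
    (hfP' : f (u P') = 0) (hgP' : g (u P') ≠ 0)
    (hfP'' : f (u P'') ≠ 0) (hgP'' : g (u P'') = 0)
    (S : Finset (ProjPoint F)) (hS : ∀ Q, Q ∈ S ↔ Q ∈ Ω ∧ Q ≠ P ∧ Q ≠ P' ∧ Q ≠ P'')
    (hf : ∀ Q ∈ S, f (u Q) ≠ 0) (hg : ∀ Q ∈ S, g (u Q) ≠ 0) :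
    ∏ Q ∈ S, (g (u Q) / f (u Q)) = -1 := by
  classical
  have key : ∏ Q ∈ S, (g (u Q) / f (u Q)) = ∏ x : Fˣ, (x : F) := by
    have hker : ∀ t : F, g - t • f ≠ 0 := by
      intro t h
      apply hgP'
      have := LinearMap.congr_fun h (u P')
      simpa [hfP'] using this
    have hmem : ∀ (t : F) (Q : ProjPoint F), Q.1 ≤ LinearMap.ker (g - t • f) ↔
        g (u Q) = t * f (u Q) := by
      intro t Q
      rw [hu Q, Submodule.span_singleton_le_iff_mem, LinearMap.mem_ker]
      simp [sub_eq_zero]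
    have hN := fun t : F => hP.2 ⟨LinearMap.ker (g - t • f), ker_two _ (hker t)⟩
      ((hmem t P).2 (by simp [hfP, hgP]))
    refine Finset.prod_bij (fun Q hQ => Units.mk0 (g (u Q) / f (u Q))
      (div_ne_zero (hg Q hQ) (hf Q hQ))) (fun _ _ => Finset.mem_univ _) ?_ ?_ ?_
    · intro A hA B hB hAB
      have hAB' : g (u A) / f (u A) = g (u B) / f (u B) := by
        simpa using congrArg Units.val hAB
      obtain ⟨R, -, hR⟩ := hN (g (u A) / f (u A))
      have hA' := (hS A).1 hA
      have hB' := (hS B).1 hB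
      have e1 := hR A ⟨hA'.1, hA'.2.1, (hmem _ A).2 (by
        rw [div_mul_cancel₀ _ (hf A hA)])⟩
      have e2 := hR B ⟨hB'.1, hB'.2.1, (hmem _ B).2 (by
        rw [hAB', div_mul_cancel₀ _ (hf B hB)])⟩
      exact e1.trans e2.symm
    · intro t _
      obtain ⟨R, ⟨hR1, hR2, hR3⟩, -⟩ := hN t
      have hR4 := (hmem _ R).1 hR3
      have hRS : R ∈ S := by
        refine (hS R).2 ⟨hR1, hR2, ?_, ?_⟩
        · rintro rfl
          rw [hfP', mul_zero] at hR4
          exact hgP' hR4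
        · rintro rfl
          rw [hgP''] at hR4
          exact mul_ne_zero t.ne_zero hfP'' hR4.symm
      refine ⟨R, hRS, ?_⟩
      ext
      simp only [Units.val_mk0]
      rw [hR4, mul_div_cancel_right₀ _ (hf R hRS)]
    · intro Q hQ
      simp
  rw [key]
  have := congrArg (Units.val) (FiniteField.prod_univ_units_id_eq_neg_one (K := F))
  simpa using this

/-- **Bichara–Korchmáros.** Let `q` be an odd prime power. Every set of `q+2`
points in `PG(2,q)` has at most two internal nuclei. -/
theorem internal_nuclei_le_two {F : Type*} [Field F] [Fintype F] (q : ℕ)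
    (hq : Fintype.card F = q) (hodd : Odd q)
    (Ω : Set (ProjPoint F)) (hΩ : Ω.ncard = q + 2) :
    {P : ProjPoint F | IsInternalNucleus Ω P}.ncard ≤ 2 := by
  classical
  by_contra hcon
  push Not at hcon
  obtain ⟨A, B, C, hA, hB, hC, hAB, hAC, hBC⟩ := (Set.two_lt_ncard_iff (Set.toFinite _)).1 hcon
  simp only [Set.mem_ofPred_eq] at hA hB hC
  choose u hu0 hu using fun Q : ProjPoint F => pp_rep Q
  have hle : ∀ (Q : ProjPoint F) (W : Submodule F (Fin 3 → F)), Q.1 ≤ W ↔ u Q ∈ W := by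
    intro Q W
    rw [hu Q, Submodule.span_singleton_le_iff_mem]
  have hpair : LinearIndependent F ![u A, u B] := by
    rw [LinearIndependent.pair_iff' (hu0 A)]
    intro a h
    apply hAB
    symm
    apply Subtype.ext
    apply Submodule.eq_of_le_of_finrank_eq _ (B.2.trans A.2.symm)
    rw [hle, hu A, ← h]
    exact Submodule.smul_mem _ _ (Submodule.mem_span_singleton_self _)
  have hline : Module.finrank F (Submodule.span F (Set.range ![u A, u B])) = 2 := by
    rw [finrank_span_eq_card hpair]; simp
  have hCn := notmem_side Ω A B C hA hB.1 hAB.symm ⟨_, hline⟩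
    ((hle _ _).2 (Submodule.subset_span ⟨0, rfl⟩)) ((hle _ _).2 (Submodule.subset_span ⟨1, rfl⟩))
    hC.1 hAC.symm hBC.symm
  rw [hle] at hCn
  have hli : LinearIndependent F ![u C, u A, u B] := linearIndependent_fin_cons.2 ⟨hpair, hCn⟩
  let b := basisOfLinearIndependentOfCardEqFinrank hli (by simp)
  have hb : ∀ i, b i = ![u C, u A, u B] i := fun i => by simp [b]
  have hc : ∀ i j, b.coord i (![u C, u A, u B] j) = if j = i then 1 else 0 := by
    intro i j
    rw [← hb, Module.Basis.coord_apply, b.repr_self, Finsupp.single_apply]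
  have c0 := fun i => hc i 0
  have c1 := fun i => hc i 1
  have c2 := fun i => hc i 2
  simp only [Matrix.cons_val] at c0 c1 c2
  have hne : ∀ i, b.coord i ≠ 0 := by
    intro i h
    have := hc i i
    rw [h] at this
    simp at this
  let S : Finset (ProjPoint F) := (Set.toFinite (Ω \ {A, B, C})).toFinset
  have hS : ∀ Q, Q ∈ S ↔ Q ∈ Ω ∧ Q ≠ A ∧ Q ≠ B ∧ Q ≠ C := by
    intro Q; simp [S]
  have n0 : ∀ Q ∈ S, b.coord 0 (u Q) ≠ 0 := by
    intro Q hQ h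
    obtain ⟨h1, h2, h3, h4⟩ := (hS Q).1 hQ
    exact notmem_side Ω A B Q hA hB.1 hAB.symm ⟨_, ker_two _ (hne 0)⟩ ((hle _ _).2 (by simp [c1, -Module.Basis.coord_apply]))
      ((hle _ _).2 (by simp [c2, -Module.Basis.coord_apply])) h1 h2 h3 ((hle _ _).2 h)
  have n1 : ∀ Q ∈ S, b.coord 1 (u Q) ≠ 0 := by
    intro Q hQ h
    obtain ⟨h1, h2, h3, h4⟩ := (hS Q).1 hQ
    exact notmem_side Ω B C Q hB hC.1 hBC.symm ⟨_, ker_two _ (hne 1)⟩ ((hle _ _).2 (by simp [c2, -Module.Basis.coord_apply]))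
      ((hle _ _).2 (by simp [c0, -Module.Basis.coord_apply])) h1 h3 h4 ((hle _ _).2 h)
  have n2 : ∀ Q ∈ S, b.coord 2 (u Q) ≠ 0 := by
    intro Q hQ h
    obtain ⟨h1, h2, h3, h4⟩ := (hS Q).1 hQ
    exact notmem_side Ω A C Q hA hC.1 hAC.symm ⟨_, ker_two _ (hne 2)⟩ ((hle _ _).2 (by simp [c1, -Module.Basis.coord_apply]))
      ((hle _ _).2 (by simp [c0, -Module.Basis.coord_apply])) h1 h2 h4 ((hle _ _).2 h)
  have p1 := prod_ratio Ω A B C u hu hA (b.coord 0) (b.coord 2) (by simp [c1, -Module.Basis.coord_apply]) (by simp [c1, -Module.Basis.coord_apply])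
    (by simp [c2, -Module.Basis.coord_apply]) (by simp [c2, -Module.Basis.coord_apply]) (by simp [c0, -Module.Basis.coord_apply]) (by simp [c0, -Module.Basis.coord_apply]) S hS n0 n2
  have p2 := prod_ratio Ω B C A u hu hB (b.coord 1) (b.coord 0) (by simp [c2, -Module.Basis.coord_apply]) (by simp [c2, -Module.Basis.coord_apply])
    (by simp [c0, -Module.Basis.coord_apply]) (by simp [c0, -Module.Basis.coord_apply]) (by simp [c1, -Module.Basis.coord_apply]) (by simp [c1, -Module.Basis.coord_apply]) S
    (fun Q => by rw [hS]; tauto) n1 n0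
  have p3 := prod_ratio Ω C A B u hu hC (b.coord 2) (b.coord 1) (by simp [c0, -Module.Basis.coord_apply]) (by simp [c0, -Module.Basis.coord_apply])
    (by simp [c1, -Module.Basis.coord_apply]) (by simp [c1, -Module.Basis.coord_apply]) (by simp [c2, -Module.Basis.coord_apply]) (by simp [c2, -Module.Basis.coord_apply]) S
    (fun Q => by rw [hS]; tauto) n2 n1
  have hall : (∏ Q ∈ S, (b.coord 2 (u Q) / b.coord 0 (u Q))) *
      (∏ Q ∈ S, (b.coord 0 (u Q) / b.coord 1 (u Q))) *
      (∏ Q ∈ S, (b.coord 1 (u Q) / b.coord 2 (u Q))) = 1 := by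
    rw [← Finset.prod_mul_distrib, ← Finset.prod_mul_distrib]
    apply Finset.prod_eq_one
    intro Q hQ
    have a0 := n0 Q hQ
    have a1 := n1 Q hQ
    have a2 := n2 Q hQ
    generalize b.coord 0 (u Q) = x at *
    generalize b.coord 1 (u Q) = y at *
    generalize b.coord 2 (u Q) = z at *
    field_simp
  rw [p1, p2, p3] at hall
  have hchar : ringChar F ≠ 2 := by
    intro h
    have := FiniteField.even_card_of_char_two h
    rw [hq] at this
    rw [Nat.odd_iff] at hodd
    omega
  exact Ring.neg_one_ne_one_of_char_ne_two hchar (by simpa using hall)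
end

section
/- Let q ≥ 7 be an odd prime power. Every Kakeya set K in AG(2,q) satisfies |K| ≥ q(q+1)/2 + (q+2)/3, i.e., 6·|K| ≥ 3q(q+1) + 2(q+2). -/
/-- `L` is an affine line in `AG(2,q) = F × F` with direction `d`, where the
`q+1` directions are indexed by `Option F`: `some m` is the parallel class of
lines of slope `m`, and `none` is the parallel class of vertical lines. -/
def IsLineWithDir {F : Type*} [Field F] (d : Option F) (L : Set (F × F)) : Prop :=
  match d with
  | none => ∃ c : F, L = {p : F × F | p.1 = c}
  | some m => ∃ b : F, L = {p : F × F | p.2 = m * p.1 + b}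

namespace Kak

open Finset

section algebra
variable {F : Type*} [Field F] [Fintype F] [DecidableEq F]

lemma prod_erase_zero : ∏ x ∈ (univ : Finset F).erase 0, x = -1 := by
  have h := FiniteField.prod_univ_units_id_eq_neg_one (K := F)
  have h2 := congrArg (Units.val) h
  rw [Units.coe_prod] at h2
  simp only [Units.val_neg, Units.val_one] at h2
  rw [← h2]
  symm
  refine Finset.prod_bij (fun (u : Fˣ) _ => (u : F)) ?_ ?_ ?_ ?_
  · intro u _; simp
  · intro u _ v _ h; exact Units.ext h
  · intro x hx
    have hx' : x ≠ 0 := by simpa using hx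
    exact ⟨Units.mk0 x hx', mem_univ _, rfl⟩
  · intro u _; rfl

lemma wilson (g : F → F) (hg : Function.Injective g) (a : F) :
    ∏ m ∈ (univ : Finset F).erase a, (g m - g a) = -1 := by
  rw [← prod_erase_zero (F := F)]
  have hb : Function.Bijective g := Finite.injective_iff_bijective.mp hg
  refine Finset.prod_bij (fun m _ => g m - g a) ?_ ?_ ?_ ?_
  · intro m hm
    have : m ≠ a := by simpa using hm
    simp [sub_eq_zero, hg.eq_iff, this]
  · intro u _ v _ h
    exact hg (sub_left_injective h)
  · intro y hy
    have hy' : y ≠ 0 := by simpa using hy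
    obtain ⟨m, hm⟩ := hb.2 (y + g a)
    refine ⟨m, ?_, by simp [hm]⟩
    simp only [mem_erase, mem_univ, and_true]
    rintro rfl
    apply hy'
    simpa using hm
  · intro u _; rfl

lemma segre_vert (h2 : (2 : F) ≠ 0) (b : F → F) (c m1 : F)
    (hv : Function.Injective fun m => b m + m * c)
    (hs : Function.Injective fun m => if m = m1 then c else (b m - b m1) / (m1 - m)) : False := by
  have w1 := wilson (fun m => -(b m + m * c)) (fun x y h => hv (neg_injective h)) m1
  have w2 := wilson _ hs m1
  have w3 := wilson (id : F → F) Function.injective_id m1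
  have e : ∏ m ∈ (univ : Finset F).erase m1,
      ((if m = m1 then c else (b m - b m1) / (m1 - m)) -
        (if m1 = m1 then c else (b m1 - b m1) / (m1 - m1))) =
      (∏ m ∈ (univ : Finset F).erase m1, (-(b m + m * c) - -(b m1 + m1 * c))) /
      ∏ m ∈ (univ : Finset F).erase m1, (id m - id m1) := by
    rw [← Finset.prod_div_distrib]
    refine Finset.prod_congr rfl fun m hm => ?_
    have hm' : m ≠ m1 := by simpa using hm
    have h1 : m1 - m ≠ 0 := sub_ne_zero.mpr hm'.symm
    have h1 : m - m1 ≠ 0 := sub_ne_zero.mpr hm'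
    simp only [hm', if_false, if_true, id]
    field_simp
    ring
  rw [w1, w3] at e
  have e' := w2.symm.trans e
  apply h2
  rw [neg_div_neg_eq, div_one] at e'
  linear_combination -e'

lemma segre_slopes (h2 : (2 : F) ≠ 0) (b : F → F) (c m1 m2 : F) (hne : m1 ≠ m2)
    (hs1 : Function.Injective fun m => if m = m1 then c else (b m - b m1) / (m1 - m))
    (hs2 : Function.Injective fun m => if m = m2 then c else (b m - b m2) / (m2 - m)) :
    False := by
  have w1 := wilson _ hs1 m2
  have w2 := wilson _ hs2 m1
  have w3 := wilson (id : F → F) Function.injective_id m1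
  have w4 := wilson (id : F → F) Function.injective_id m2
  have hd : m1 - m2 ≠ 0 := sub_ne_zero.mpr hne
  have hd' : m2 - m1 ≠ 0 := sub_ne_zero.mpr hne.symm
  have m1in : m1 ∈ (univ : Finset F).erase m2 := by simp [hne]
  have m2in : m2 ∈ (univ : Finset F).erase m1 := by simp [hne.symm]
  rw [← Finset.mul_prod_erase _ _ m1in] at w1 w4
  rw [← Finset.mul_prod_erase _ _ m2in] at w2 w3
  rw [Finset.erase_right_comm] at w2 w3
  set S := ((univ : Finset F).erase m2).erase m1 with hS
  set x0 := (b m2 - b m1) / (m1 - m2) with hx0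
  have hx0' : (b m1 - b m2) / (m2 - m1) = x0 := by
    rw [hx0, ← neg_sub (b m1), ← neg_sub m2 m1, neg_div_neg_eq]
  have hx1 : x0 * (m1 - m2) = b m2 - b m1 := by rw [hx0]; field_simp
  simp only [hne, hne.symm, if_true, if_false, hx0', ← hx0, id] at w1 w2 w3 w4
  have e1 : ∏ m ∈ S, ((if m = m1 then c else (b m - b m1) / (m1 - m)) - x0)
      = (∏ m ∈ S, -(b m + m * x0 - b m1 - m1 * x0)) / ∏ m ∈ S, (m - m1) := by
    rw [← Finset.prod_div_distrib]
    refine Finset.prod_congr rfl fun m hm => ?_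
    have hm' : m ≠ m1 := by simp [hS] at hm; tauto
    have h1 : m1 - m ≠ 0 := sub_ne_zero.mpr hm'.symm
    have h1' : m - m1 ≠ 0 := sub_ne_zero.mpr hm'
    rw [if_neg hm', div_sub' h1, div_eq_div_iff h1 h1']
    ring
  have e2 : ∏ m ∈ S, ((if m = m2 then c else (b m - b m2) / (m2 - m)) - x0)
      = (∏ m ∈ S, -(b m + m * x0 - b m1 - m1 * x0)) / ∏ m ∈ S, (m - m2) := by
    rw [← Finset.prod_div_distrib]
    refine Finset.prod_congr rfl fun m hm => ?_
    have hm' : m ≠ m2 := by simp [hS] at hm; tauto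
    have h1 : m2 - m ≠ 0 := sub_ne_zero.mpr hm'.symm
    have h1' : m - m2 ≠ 0 := sub_ne_zero.mpr hm'
    rw [if_neg hm', div_sub' h1, div_eq_div_iff h1 h1']
    linear_combination (m - m2) * hx1
  rw [e1] at w1
  rw [e2] at w2
  generalize (∏ m ∈ S, -(b m + m * x0 - b m1 - m1 * x0)) = B at *
  generalize (∏ m ∈ S, (m - m1)) = A1 at *
  generalize (∏ m ∈ S, (m - m2)) = A2 at *
  have hA1 : A1 ≠ 0 := by rintro rfl; simp at w3
  have hA2 : A2 ≠ 0 := by rintro rfl; simp at w4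
  rw [mul_div_assoc', div_eq_iff hA1] at w1
  rw [mul_div_assoc', div_eq_iff hA2] at w2
  have hA : A1 = A2 := by linear_combination w1 - w2
  subst hA
  apply h2
  linear_combination w3 + w4

/-- Jamison / Brouwer–Schrijver in the plane. -/
lemma jamison (B : Finset (F × F))
    (hB : ∀ a b c : F, (a, b) ≠ (0, 0) → ∃ p ∈ B, a * p.1 + b * p.2 = c) :
    2 * Fintype.card F - 1 ≤ B.card := by
  classical
  obtain ⟨o, ho, -⟩ := hB 1 0 0 (by simp)
  by_contra hlt
  push Not at hlt
  let f : MvPolynomial (Fin 2) F :=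
    ∏ p ∈ B.erase o, (MvPolynomial.C (p.1 - o.1) * MvPolynomial.X 0 +
      MvPolynomial.C (p.2 - o.2) * MvPolynomial.X 1 - MvPolynomial.C 1)
  have hq := Fintype.one_lt_card (α := F)
  have hdeg : f.totalDegree < (Fintype.card F - 1) * Fintype.card (Fin 2) := by
    have h1 : f.totalDegree ≤ ∑ p ∈ B.erase o, 1 := by
      refine (MvPolynomial.totalDegree_finsetProd _ _).trans (Finset.sum_le_sum fun p _ => ?_)
      have hX : ∀ (a : F) (i : Fin 2),
          (MvPolynomial.C a * MvPolynomial.X i : MvPolynomial (Fin 2) F).totalDegree ≤ 1 := by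
        intro a i
        refine (MvPolynomial.totalDegree_mul _ _).trans ?_
        simp
      refine (MvPolynomial.totalDegree_sub _ _).trans (max_le ?_ (by simp))
      exact (MvPolynomial.totalDegree_add _ _).trans (max_le (hX _ _) (hX _ _))
    rw [Finset.sum_const, Finset.card_erase_of_mem ho] at h1
    simp only [smul_eq_mul, mul_one, Fintype.card_fin] at *
    have := Finset.card_pos.mpr ⟨o, ho⟩
    omega
  have hsum := MvPolynomial.sum_eval_eq_zero f hdeg
  rw [Finset.sum_eq_single (0 : Fin 2 → F)] at hsum
  · simp only [f, map_prod] at hsum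
    rw [Finset.prod_eq_zero_iff] at hsum
    obtain ⟨p, _, hp⟩ := hsum
    simp at hp
  · intro x _ hx
    simp only [f, map_prod]
    rw [Finset.prod_eq_zero_iff]
    obtain ⟨p, hp, hpe⟩ := hB (x 0) (x 1) (x 0 * o.1 + x 1 * o.2 + 1) (by
      intro h
      apply hx
      ext i
      simp only [Prod.mk.injEq] at h
      fin_cases i
      · exact h.1
      · exact h.2)
    refine ⟨p, ?_, ?_⟩
    · rw [mem_erase]
      refine ⟨?_, hp⟩
      rintro rfl
      simp at hpe
    · simp
      linear_combination hpe
  · simp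

end algebra

section lines
variable {F : Type*} [Field F] [Fintype F]

lemma line_card {d : Option F} {l : Set (F × F)} (h : IsLineWithDir d l) :
    l.ncard = Fintype.card F := by
  rw [← Nat.card_eq_fintype_card, ← Set.ncard_univ]
  symm
  cases d with
  | none =>
    obtain ⟨c, rfl⟩ := h
    refine Set.ncard_congr (fun y _ => (c, y)) ?_ ?_ ?_
    · intro y _; simp
    · intro x y _ _ h; simpa using h
    · rintro ⟨x, y⟩ h; exact ⟨y, trivial, by simp at h; simp [h]⟩
  | some m =>
    obtain ⟨b, rfl⟩ := h
    refine Set.ncard_congr (fun x _ => (x, m * x + b)) ?_ ?_ ?_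
    · intro y _; simp
    · intro x y _ _ h; simp at h; exact h.1
    · rintro ⟨x, y⟩ h; exact ⟨x, trivial, by simp at h; simp [h]⟩

lemma line_inter {d e : Option F} {l k : Set (F × F)} (h : IsLineWithDir d l)
    (h' : IsLineWithDir e k) (hde : d ≠ e) : (l ∩ k).ncard = 1 := by
  rw [Set.ncard_eq_one]
  rcases d with _ | m <;> rcases e with _ | n
  · exact absurd rfl hde
  · obtain ⟨c, rfl⟩ := h
    obtain ⟨b, rfl⟩ := h'
    refine ⟨(c, n * c + b), ?_⟩
    ext ⟨x, y⟩
    simp only [Set.mem_inter_iff, Set.mem_setOf_eq, Set.mem_singleton_iff, Prod.mk.injEq]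
    constructor
    · rintro ⟨rfl, rfl⟩; simp
    · rintro ⟨rfl, rfl⟩; simp
  · obtain ⟨c, rfl⟩ := h'
    obtain ⟨b, rfl⟩ := h
    refine ⟨(c, m * c + b), ?_⟩
    ext ⟨x, y⟩
    simp only [Set.mem_inter_iff, Set.mem_setOf_eq, Set.mem_singleton_iff, Prod.mk.injEq]
    constructor
    · rintro ⟨rfl, rfl⟩; simp
    · rintro ⟨rfl, rfl⟩; simp
  · obtain ⟨b, rfl⟩ := h
    obtain ⟨c, rfl⟩ := h'
    have hmn : m - n ≠ 0 := sub_ne_zero.mpr fun h => hde (by rw [h])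
    refine ⟨((c - b) / (m - n), m * ((c - b) / (m - n)) + b), ?_⟩
    ext ⟨x, y⟩
    simp only [Set.mem_inter_iff, Set.mem_setOf_eq, Set.mem_singleton_iff, Prod.mk.injEq]
    constructor
    · rintro ⟨h1, h2⟩
      have : x = (c - b) / (m - n) := by
        rw [eq_div_iff hmn]; linear_combination h2 - h1
      rw [← this]; exact ⟨rfl, h1⟩
    · rintro ⟨rfl, rfl⟩
      refine ⟨rfl, ?_⟩
      field_simp
      ring

lemma line_par {d : Option F} {l k : Set (F × F)} (h : IsLineWithDir d l)
    (h' : IsLineWithDir d k) (hne : l ≠ k) : (l ∩ k).ncard = 0 := by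
  rw [Set.ncard_eq_zero]
  by_contra hx
  rw [← ne_eq, ← Set.nonempty_iff_ne_empty] at hx
  obtain ⟨⟨x, y⟩, h1, h2⟩ := hx
  apply hne
  rcases d with _ | m
  · obtain ⟨c, rfl⟩ := h
    obtain ⟨b, rfl⟩ := h'
    simp only [Set.mem_setOf_eq] at h1 h2
    rw [← h1, ← h2]
  · obtain ⟨c, rfl⟩ := h
    obtain ⟨b, rfl⟩ := h'
    simp only [Set.mem_setOf_eq] at h1 h2
    have : c = b := by linear_combination h2 - h1
    rw [this]

lemma line_exists (a b c : F) (h : (a, b) ≠ (0, 0)) :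
    ∃ d, IsLineWithDir d {p : F × F | a * p.1 + b * p.2 = c} := by
  by_cases hb : b = 0
  · subst hb
    have ha : a ≠ 0 := by rintro rfl; exact h rfl
    refine ⟨none, c / a, ?_⟩
    ext p
    simp only [Set.mem_setOf_eq]
    rw [eq_div_iff ha]
    constructor <;> intro h <;> linear_combination h
  · refine ⟨some (-a / b), c / b, ?_⟩
    ext p
    simp only [Set.mem_setOf_eq]
    have : -a / b * p.1 + c / b = (c - a * p.1) / b := by field_simp; ring
    rw [this, eq_div_iff hb]
    constructor <;> intro h <;> linear_combination h

/-- At most one defining line carries only double points. -/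
lemma segre (h2 : (2 : F) ≠ 0) (L : Option F → Set (F × F)) (hL : ∀ d, IsLineWithDir d (L d))
    (d e : Option F)
    (hd : ∀ p ∈ L d, ∀ f g, f ≠ d → g ≠ d → p ∈ L f → p ∈ L g → f = g)
    (he : ∀ p ∈ L e, ∀ f g, f ≠ e → g ≠ e → p ∈ L f → p ∈ L g → f = g) : d = e := by
  classical
  obtain ⟨c, hc⟩ := hL none
  have hb : ∀ m, ∃ b : F, L (some m) = {p : F × F | p.2 = m * p.1 + b} := fun m => hL (some m)
  choose b hb using hb
  have slope : ∀ m1 : F, (∀ p ∈ L (some m1), ∀ f g, f ≠ some m1 → g ≠ some m1 →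
      p ∈ L f → p ∈ L g → f = g) →
      Function.Injective fun m => if m = m1 then c else (b m - b m1) / (m1 - m) := by
    intro m1 h
    let φ : F → Option F := fun m => if m = m1 then none else some m
    let g : F → F := fun m => if m = m1 then c else (b m - b m1) / (m1 - m)
    have key : ∀ m, (g m, m1 * g m + b m1) ∈ L (φ m) := by
      intro m
      by_cases hm : m = m1
      · simp [φ, g, hm, hc]
      · have : m1 - m ≠ 0 := sub_ne_zero.mpr fun h => hm h.symm
        simp only [φ, g, hm, if_false, hb, Set.mem_setOf_eq]
        field_simp
        ring
    have hφ : ∀ m, φ m ≠ some m1 := by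
      intro m
      by_cases hm : m = m1 <;> simp [φ, hm]
    intro m n hmn
    have hmn' : g m = g n := hmn
    have h3 := h (g m, m1 * g m + b m1) (by simp [hb]) (φ m) (φ n) (hφ m) (hφ n) (key m)
      (by rw [hmn']; exact key n)
    by_cases hm : m = m1 <;> by_cases hn : n = m1 <;> simp [φ, hm, hn] at h3 ⊢
    exact h3
  have vert : (∀ p ∈ L none, ∀ f g, f ≠ none → g ≠ none →
      p ∈ L f → p ∈ L g → f = g) → Function.Injective fun m => b m + m * c := by
    intro h m n hmn
    have hmn' : b m + m * c = b n + n * c := hmn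
    have := h (c, b m + m * c) (by simp [hc]) (some m) (some n) (by simp) (by simp)
      (by rw [hb]; simp only [Set.mem_setOf_eq]; ring)
      (by rw [hb]; simp only [Set.mem_setOf_eq]; rw [hmn']; ring)
    simpa using this
  rcases d with _ | m1 <;> rcases e with _ | m2
  · rfl
  · exact (segre_vert h2 b c m2 (vert hd) (slope m2 he)).elim
  · exact (segre_vert h2 b c m1 (vert he) (slope m1 hd)).elim
  · by_contra hne
    exact segre_slopes h2 b c m1 m2 (fun h => hne (by rw [h])) (slope m1 hd) (slope m2 he)

open Classical in
/-- Multiplicity of a point. -/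
noncomputable def mult (L : Option F → Set (F × F)) (p : F × F) : ℕ :=
  (univ.filter fun d => p ∈ L d).card

open Classical in
lemma sum_mult (L : Option F → Set (F × F)) (l : Set (F × F)) :
    ∑ p ∈ univ.filter (· ∈ l), mult L p = ∑ e, (l ∩ L e).ncard := by
  unfold mult
  simp only [Finset.card_filter]
  rw [Finset.sum_comm]
  refine Finset.sum_congr rfl fun e _ => ?_
  rw [← Finset.card_filter, Finset.filter_filter, Set.ncard_eq_toFinset_card']
  congr 1
  ext p
  simp

open Classical in
lemma sum_inter (L : Option F → Set (F × F)) (hL : ∀ d, IsLineWithDir d (L d))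
    (l : Set (F × F)) (d : Option F) (hl : IsLineWithDir d l) :
    ∑ e, (l ∩ L e).ncard = Fintype.card F + (l ∩ L d).ncard := by
  rw [← Finset.add_sum_erase _ _ (mem_univ d), add_comm]
  congr 1
  rw [Finset.sum_congr rfl (g := fun _ => 1)]
  · simp [Finset.card_erase_of_mem]
  · intro e he
    exact line_inter hl (hL e) (by simpa [eq_comm] using he)

open Classical in
lemma odd_count (hodd : Odd (Fintype.card F))
    (L : Option F → Set (F × F)) (hL : ∀ d, IsLineWithDir d (L d)) :
    2 * Fintype.card F - 2 ≤ (univ.filter fun p => Odd (mult L p)).card := by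
  have h2 : (2 : F) ≠ 0 := by
    apply Ring.two_ne_zero
    intro h
    rw [FiniteField.even_card_iff_char_two] at h
    rw [Nat.odd_iff] at hodd
    omega
  set O := (univ.filter fun p => Odd (mult L p)) with hO
  have hmemO : ∀ p, p ∈ O ↔ Odd (mult L p) := by simp [hO]
  -- non-defining lines
  have hnd : ∀ d l, IsLineWithDir d l → l ≠ L d → ∃ p ∈ O, p ∈ l := by
    intro d l hl hne
    by_contra! hcon
    have h1 := sum_mult L l
    rw [sum_inter L hL l d hl, line_par hl (hL d) hne, add_zero] at h1
    rw [← h1] at hodd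
    rw [← Nat.not_even_iff_odd] at hodd
    apply hodd
    refine Finset.even_sum _ fun p hp => ?_
    rw [← Nat.not_odd_iff_even, ← hmemO]
    exact fun h => hcon p h (by simpa using hp)
  have hdef : ∀ d, (∀ p ∈ O, p ∉ L d) →
      (∀ p ∈ L d, ∀ f g, f ≠ d → g ≠ d → p ∈ L f → p ∈ L g → f = g) := by
    intro d hcon
    have h1 := sum_mult L (L d)
    rw [sum_inter L hL (L d) d (hL d), Set.inter_self, line_card (hL d)] at h1
    have hcard : (univ.filter (· ∈ L d)).card = Fintype.card F := by
      rw [← line_card (hL d), Set.ncard_eq_toFinset_card']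
      congr 1
      ext p; simp
    have hge : ∀ p ∈ univ.filter (· ∈ L d), 2 ≤ mult L p := by
      intro p hp
      have hp' : p ∈ L d := by simpa using hp
      have hev : Even (mult L p) := by
        rw [← Nat.not_odd_iff_even, ← hmemO]
        exact fun h => hcon p h hp'
      have hpos : 0 < mult L p := Finset.card_pos.mpr ⟨d, by simpa using hp'⟩
      obtain ⟨k, hk⟩ := hev
      omega
    have hs : ∑ p ∈ univ.filter (· ∈ L d), 2 = ∑ p ∈ univ.filter (· ∈ L d), mult L p := by
      rw [h1, Finset.sum_const, hcard, smul_eq_mul]; ring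
    have heq := (Finset.sum_eq_sum_iff_of_le hge).mp hs
    intro p hp f g hf hg hpf hpg
    by_contra hfg
    have hm := heq p (by simpa using hp)
    have : ({d, f, g} : Finset (Option F)) ⊆ univ.filter fun d => p ∈ L d := by
      intro x hx
      simp only [mem_insert, mem_singleton] at hx
      rcases hx with rfl | rfl | rfl <;> simpa
    have hc := Finset.card_le_card this
    rw [Finset.card_eq_three.mpr ⟨d, f, g, hf.symm, hg.symm, hfg, rfl⟩] at hc
    unfold mult at hm
    omega
  have hx0 : ∃ x0 : F × F, ∀ d, (∀ p ∈ O, p ∉ L d) → x0 ∈ L d := by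
    by_cases h : ∃ d, ∀ p ∈ O, p ∉ L d
    · obtain ⟨d, hd⟩ := h
      have : (L d).Nonempty := by
        rw [← Set.ncard_pos, line_card (hL d)]
        exact Fintype.card_pos
      obtain ⟨x, hx⟩ := this
      refine ⟨x, fun e he => ?_⟩
      rwa [segre h2 L hL e d (hdef e he) (hdef d hd)]
    · push Not at h
      refine ⟨0, fun d hd => ?_⟩
      obtain ⟨p, hp, hp'⟩ := h d
      exact absurd hp' (hd p hp)
  obtain ⟨x0, hx0⟩ := hx0
  have hj := jamison (insert x0 O) (by
    intro a b c hab
    obtain ⟨d, hl⟩ := line_exists a b c hab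
    by_cases hne : {p : F × F | a * p.1 + b * p.2 = c} = L d
    · by_cases hd : ∀ p ∈ O, p ∉ L d
      · have := hx0 d hd
        rw [← hne] at this
        exact ⟨x0, by simp, this⟩
      · push Not at hd
        obtain ⟨p, hp, hp'⟩ := hd
        rw [← hne] at hp'
        exact ⟨p, by simp [hp], hp'⟩
    · obtain ⟨p, hp, hp'⟩ := hnd d _ hl hne
      exact ⟨p, by simp [hp], hp'⟩)
  have := Finset.card_insert_le x0 O
  omega

open Classical in
lemma main (hodd : Odd (Fintype.card F))
    (L : Option F → Set (F × F)) (hL : ∀ d, IsLineWithDir d (L d)) :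
    2 * Fintype.card F - 2 + 2 * (Fintype.card F * (Fintype.card F + 1)) ≤
      4 * (⋃ d, L d).ncard := by
  set q := Fintype.card F with hq
  have h0 := odd_count hodd L hL
  have h1 : ∑ p, mult L p = q * (q + 1) := by
    have := sum_mult L Set.univ
    simp only [Set.mem_univ, Finset.filter_true, Set.univ_inter] at this
    rw [this, Finset.sum_congr rfl fun e _ => line_card (hL e)]
    simp [hq]; ring
  have h2 : ∑ p, mult L p ^ 2 = 2 * (q * (q + 1)) := by
    have : ∀ p, mult L p ^ 2 = ∑ d, if p ∈ L d then mult L p else 0 := by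
      intro p
      rw [← Finset.sum_filter, Finset.sum_const, smul_eq_mul, sq]
      rfl
    rw [Finset.sum_congr rfl fun p _ => this p, Finset.sum_comm]
    have : ∀ d, ∑ p, (if p ∈ L d then mult L p else 0) = 2 * q := by
      intro d
      rw [← Finset.sum_filter, sum_mult, sum_inter L hL _ d (hL d), Set.inter_self,
        line_card (hL d)]
      ring
    rw [Finset.sum_congr rfl fun d _ => this d]
    simp [hq]; ring
  have h3 : (⋃ d, L d).ncard = ∑ p, if 0 < mult L p then 1 else 0 := by
    rw [← Finset.card_filter, Set.ncard_eq_toFinset_card']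
    congr 1
    ext p
    simp [mult, Finset.card_pos, Finset.Nonempty]
  rw [Finset.card_filter] at h0
  have h4 : ∑ p, ((if Odd (mult L p) then 1 else 0) + 4 * mult L p) ≤
      ∑ p, (4 * (if 0 < mult L p then 1 else 0) + mult L p ^ 2) := by
    refine Finset.sum_le_sum fun p _ => ?_
    generalize mult L p = m
    rcases Nat.lt_or_ge m 5 with h | h
    · interval_cases m <;> decide
    · have : 0 < m := by omega
      simp only [this, if_true]
      split_ifs <;> nlinarith
  rw [Finset.sum_add_distrib, Finset.sum_add_distrib, ← Finset.mul_sum, ← Finset.mul_sum, h1, h2,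
    ← h3] at h4
  omega

end lines

end Kak

/-- **Blokhuis–Bruen.** For `q ≥ 7` an odd prime power, every Kakeya set `K` in
`AG(2,q)` satisfies `|K| ≥ q(q+1)/2 + (q+2)/3`, i.e. `6|K| ≥ 3q(q+1) + 2(q+2)`. -/
theorem kakeya_blokhuis_bruen {F : Type*} [Field F] [Fintype F] (q : ℕ)
    (hq : Fintype.card F = q) (hodd : Odd q) (h7 : 7 ≤ q)
    (L : Option F → Set (F × F)) (hL : ∀ d, IsLineWithDir d (L d))
    (K : Set (F × F)) (hK : K = ⋃ d, L d) :
    3 * q * (q + 1) + 2 * (q + 2) ≤ 6 * K.ncard := by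
  subst hq hK
  have h := Kak.main hodd L hL
  rw [mul_assoc]
  omega
end

section
/- For every even prime power q > 2 there exists a Kakeya set K in AG(2,q) with |K| = q(q+1)/2 (namely, the Kakeya set associated to a dual hyperoval and one of its lines). -/
/-- For every even prime power `q > 2` there exists a Kakeya set `K` in
`AG(2,q)` with `|K| = q(q+1)/2`, i.e. `2|K| = q(q+1)` (the Kakeya set
associated to a dual hyperoval and one of its lines). -/
theorem kakeya_exists_even {F : Type*} [Field F] [Fintype F] (q : ℕ)
    (hq : Fintype.card F = q) (heven : Even q) (hq2 : 2 < q) :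
    ∃ L : Option F → Set (F × F), (∀ d, IsLineWithDir d (L d)) ∧
      2 * (⋃ d, L d).ncard = q * (q + 1) := by
  classical
  have h2 : ringChar F = 2 := by
    rw [FiniteField.even_card_iff_char_two, hq]
    exact Nat.even_iff.mp heven
  have : CharP F 2 := by
    rw [← h2]; exact ringChar.charP F
  have two0 : (2 : F) = 0 := CharTwo.two_eq_zero
  refine ⟨fun d => match d with
    | none => {p : F × F | p.1 = 0}
    | some m => {p : F × F | p.2 = m * p.1 + m ^ 2}, ?_, ?_⟩
  · rintro (_ | m)
    · exact ⟨0, rfl⟩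
    · exact ⟨m ^ 2, rfl⟩
  let f : F × F → F × F := fun p => (p.1, p.2 * p.1 + p.2 ^ 2)
  let S : Finset (F × F) := (Finset.univ.erase (0 : F)) ×ˢ (Finset.univ : Finset F)
  let V : Finset (F × F) := ({0} : Finset F) ×ˢ (Finset.univ : Finset F)
  have hS : S.card = (q - 1) * q := by
    simp [S, Finset.card_product, Finset.card_erase_of_mem, hq]
  have hV : V.card = q := by
    simp [V, Finset.card_product, hq]
  have himg : S.card = (S.image f).card * 2 := by
    rw [Finset.card_eq_sum_card_image f S]
    apply Finset.sum_const_nat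
    intro y hy
    obtain ⟨⟨c, m⟩, hp, rfl⟩ := Finset.mem_image.mp hy
    have hc : c ≠ 0 := by simpa [S] using hp
    have : S.filter (fun x => f x = f (c, m)) = {(c, m), (c, m + c)} := by
      ext ⟨a, n⟩
      simp only [Finset.mem_filter, Finset.mem_insert, Finset.mem_singleton, Prod.mk.injEq, f, S,
        Finset.mem_product, Finset.mem_erase, Finset.mem_univ, and_true]
      constructor
      · rintro ⟨ha, rfl, h⟩
        have h' : (n - m) * (n - (m + a)) = 0 := by
          linear_combination h - (m * n + n * a - m ^ 2 - m * a) * two0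
        rcases mul_eq_zero.mp h' with h' | h'
        · left; exact ⟨rfl, sub_eq_zero.mp h'⟩
        · right; exact ⟨rfl, sub_eq_zero.mp h'⟩
      · rintro (⟨rfl, rfl⟩ | ⟨rfl, rfl⟩)
        · exact ⟨hc, rfl, rfl⟩
        · refine ⟨hc, rfl, ?_⟩
          linear_combination (a ^ 2 + m * a) * two0
    rw [this, Finset.card_pair]
    simpa using hc
  have hdisj : Disjoint V (S.image f) := by
    rw [Finset.disjoint_left]
    rintro ⟨a, b⟩ h1 h3
    obtain ⟨⟨c, m⟩, hp, h⟩ := Finset.mem_image.mp h3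
    simp only [f, Prod.mk.injEq] at h
    have hc : c ≠ 0 := by simpa [S] using hp
    have ha : a = 0 := by simpa [V, eq_comm] using h1
    exact hc (h.1.trans ha)
  have hU : (⋃ d : Option F, (match d with
    | none => {p : F × F | p.1 = 0}
    | some m => {p : F × F | p.2 = m * p.1 + m ^ 2} : Set (F × F)))
      = ((V ∪ S.image f : Finset (F × F)) : Set (F × F)) := by
    ext ⟨a, b⟩
    rw [Set.mem_iUnion, Finset.mem_coe, Finset.mem_union, Finset.mem_image]
    have hVm : (a, b) ∈ V ↔ a = 0 := by simp [V, eq_comm]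
    rw [hVm]
    constructor
    · rintro ⟨_ | m, h⟩
      · exact Or.inl h
      · by_cases ha : a = 0
        · exact Or.inl ha
        · refine Or.inr ⟨(a, m), by simpa [S] using ha, ?_⟩
          have h' : b = m * a + m ^ 2 := h
          simp [f, h']
    · rintro (h | ⟨⟨c, m⟩, hp, h⟩)
      · exact ⟨none, h⟩
      · simp only [f, Prod.mk.injEq] at h
        obtain ⟨rfl, rfl⟩ := h
        exact ⟨some m, rfl⟩
  refine (congrArg (fun s : Set (F × F) => 2 * s.ncard) hU).trans ?_
  simp only [Set.ncard_coe_finset]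
  rw [Finset.card_union_of_disjoint hdisj, hV]
  obtain ⟨k, rfl⟩ : ∃ k, q = k + 1 := ⟨q - 1, by omega⟩
  rw [hS, Nat.add_sub_cancel] at himg
  linarith
end

section
/- For every odd prime power q there exists a Kakeya set K in AG(2,q) with |K| = q(q+1)/2 + (q−1)/2 (namely, the Kakeya set associated to a dual oval, one of its lines, and one additional line). -/
theorem two_mul_ncard_squares {F : Type*} [Field F] [Fintype F] (h2 : ringChar F ≠ 2) :
    2 * ({a : F | IsSquare a}).ncard = Fintype.card F + 1 := by
  classical
  have h := quadraticChar_sum_zero h2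
  have e : ∀ a : F, quadraticChar F a =
      2 * (if IsSquare a then 1 else 0) - (if a = 0 then 1 else 0) - 1 := by
    intro a
    by_cases h0 : a = 0
    · subst h0; simp
    · by_cases hs : IsSquare a
      · rw [(quadraticChar_one_iff_isSquare h0).2 hs]; simp [hs, h0]
      · rw [quadraticChar_neg_one_iff_not_isSquare.2 hs]; simp [hs, h0]
  simp_rw [e] at h
  rw [Finset.sum_sub_distrib, Finset.sum_sub_distrib, ← Finset.mul_sum] at h
  have h0 : ∑ a : F, (if a = 0 then (1 : ℤ) else 0) = 1 := by simp
  have h1 : ∑ a : F, (1 : ℤ) = Fintype.card F := by simp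
  rw [h0, h1, Finset.sum_boole] at h
  have hc : ({a : F | IsSquare a}).ncard = (Finset.univ.filter (fun a : F => IsSquare a)).card := by
    rw [← Set.ncard_coe_finset]; simp
  rw [hc]
  omega

/-- For every odd prime power `q` there exists a Kakeya set `K` in `AG(2,q)`
with `|K| = q(q+1)/2 + (q-1)/2`, i.e. `2|K| = q(q+1) + (q-1)` (the Kakeya set
associated to a dual oval, one of its lines, and one additional line). -/
theorem kakeya_exists_odd {F : Type*} [Field F] [Fintype F] (q : ℕ)
    (hq : Fintype.card F = q) (hodd : Odd q) :
    ∃ L : Option F → Set (F × F), (∀ d, IsLineWithDir d (L d)) ∧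
      2 * (⋃ d, L d).ncard = q * (q + 1) + (q - 1) := by
  classical
  have h2 : ringChar F ≠ 2 := by
    intro h
    have := FiniteField.even_card_iff_char_two.1 h
    rw [hq] at this
    rw [Nat.odd_iff] at hodd
    omega
  have h20 : (2 : F) ≠ 0 := Ring.two_ne_zero h2
  have hS := two_mul_ncard_squares (F := F) h2
  refine ⟨fun d => match d with
    | none => {p | p.1 = 0}
    | some m => {p | p.2 = m * p.1 + (-m ^ 2)}, ?_, ?_⟩
  · rintro (_ | m)
    · exact ⟨0, rfl⟩
    · exact ⟨_, rfl⟩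
  set S : Set F := {a : F | IsSquare a} with hSdef
  let f : F × F → F × F := fun p => (p.1, (p.1 ^ 2 - p.2) / 4)
  have h4 : (4 : F) ≠ 0 := by
    have : (4 : F) = 2 * 2 := by norm_num
    rw [this]; exact mul_ne_zero h20 h20
  have hf : Function.Injective f := by
    rintro ⟨a, b⟩ ⟨c, d⟩ h
    simp only [f, Prod.mk.injEq] at h
    obtain ⟨rfl, h⟩ := h
    field_simp at h
    simpa using h
  have hK : (⋃ d : Option F, (match d with
    | none => {p | p.1 = 0}
    | some m => {p | p.2 = m * p.1 + (-m ^ 2)} : Set (F × F))) =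
      f '' (({0} ×ˢ Set.univ) ∪ (({0}ᶜ : Set F) ×ˢ S)) := by
    ext ⟨x, y⟩
    rw [Set.mem_iUnion]
    constructor
    · intro h
      refine ⟨(x, x ^ 2 - 4 * y), ?_, ?_⟩
      · by_cases hx : x = 0
        · left; simp [hx]
        · right
          refine ⟨hx, ?_⟩
          obtain ⟨_ | m, h⟩ := h
          · exact absurd h hx
          · have h : y = m * x + (-m ^ 2) := h
            refine ⟨x - 2 * m, ?_⟩
            simp only [h]; ring
      · simp only [f, Prod.mk.injEq, true_and]
        field_simp
        ring
    · rintro ⟨⟨a, b⟩, h, h'⟩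
      simp only [f, Prod.mk.injEq] at h'
      obtain ⟨rfl, rfl⟩ := h'
      rcases h with ⟨h, -⟩ | ⟨-, r, h⟩
      · exact ⟨none, h⟩
      · refine ⟨some ((a - r) / 2), ?_⟩
        simp only at h
        subst h
        change (a ^ 2 - r * r) / 4 = (a - r) / 2 * a + (-((a - r) / 2) ^ 2)
        have : (4 : F) = 2 * 2 := by norm_num
        rw [this]
        field_simp
        ring
  rw [hK, Set.ncard_image_of_injective _ hf, Set.ncard_union_eq, Set.ncard_prod, Set.ncard_prod,
    Set.ncard_singleton, Set.ncard_univ, Set.ncard_compl, Set.ncard_singleton,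
    Nat.card_eq_fintype_card, hq]
  · rw [hq] at hS
    have hq1 : 1 ≤ q := hodd.pos
    obtain ⟨k, rfl⟩ := Nat.exists_eq_add_of_le hq1
    have e : 1 + k - 1 = k := by omega
    rw [e]
    nlinarith
  · rw [Set.disjoint_left]
    rintro ⟨a, b⟩ ⟨h, -⟩ ⟨h', -⟩
    exact h' h
end

section
/- (Incidence formula) Let K = ⋃_d L_d be a Kakeya set in AG(2,q) with defining lines L_d. Then |K| = q(q+1)/2 + Σ_{A ∈ K} (m_A − 1)(m_A − 2)/2, where for A ∈ K, m_A is the number of directions d with A ∈ L_d. -/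
theorem aux_card_line {F : Type*} [Field F] [Fintype F] (d : Option F) (L : Set (F × F))
    (h : IsLineWithDir d L) : L.ncard = Fintype.card F := by
  rw [← Nat.card_eq_fintype_card, ← Set.ncard_univ]
  cases d with
  | none =>
    obtain ⟨c, rfl⟩ := h
    have : {p : F × F | p.1 = c} = (fun y : F => (c, y)) '' Set.univ := by
      ext ⟨x, y⟩
      simp [eq_comm]
    rw [this]
    exact Set.ncard_image_of_injective _ (fun a b hab => (Prod.ext_iff.1 hab).2)
  | some m =>
    obtain ⟨b, rfl⟩ := h
    have : {p : F × F | p.2 = m * p.1 + b} = (fun x : F => (x, m * x + b)) '' Set.univ := by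
      ext ⟨x, y⟩
      simp [eq_comm]
    rw [this]
    exact Set.ncard_image_of_injective _ (fun a b hab => (Prod.ext_iff.1 hab).1)

theorem aux_inter {F : Type*} [Field F] (d e : Option F) (hde : d ≠ e) (L M : Set (F × F))
    (h : IsLineWithDir d L) (h' : IsLineWithDir e M) : (L ∩ M).ncard = 1 := by
  rw [Set.ncard_eq_one]
  cases d with
  | none =>
    cases e with
    | none => exact absurd rfl hde
    | some m =>
      obtain ⟨c, rfl⟩ := h
      obtain ⟨b, rfl⟩ := h'
      refine ⟨(c, m * c + b), ?_⟩
      ext ⟨x, y⟩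
      simp only [Set.mem_inter_iff, Set.mem_ofPred_eq, Set.mem_singleton_iff, Prod.mk.injEq]
      constructor
      · rintro ⟨rfl, h⟩; exact ⟨rfl, h⟩
      · rintro ⟨rfl, h⟩; exact ⟨rfl, h⟩
  | some n =>
    cases e with
    | none =>
      obtain ⟨b, rfl⟩ := h
      obtain ⟨c, rfl⟩ := h'
      refine ⟨(c, n * c + b), ?_⟩
      ext ⟨x, y⟩
      simp only [Set.mem_inter_iff, Set.mem_ofPred_eq, Set.mem_singleton_iff, Prod.mk.injEq]
      constructor
      · rintro ⟨h, rfl⟩; exact ⟨rfl, h⟩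
      · rintro ⟨rfl, h⟩; exact ⟨h, rfl⟩
    | some m =>
      obtain ⟨b, rfl⟩ := h
      obtain ⟨c, rfl⟩ := h'
      have hnm : n - m ≠ 0 := fun h => hde (congrArg some (sub_eq_zero.1 h))
      refine ⟨((c - b) / (n - m), n * ((c - b) / (n - m)) + b), ?_⟩
      ext ⟨x, y⟩
      simp only [Set.mem_inter_iff, Set.mem_ofPred_eq, Set.mem_singleton_iff, Prod.mk.injEq]
      constructor
      · rintro ⟨h1, h2⟩
        have hx : x = (c - b) / (n - m) := by
          rw [eq_div_iff hnm]; linear_combination h2 - h1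
        exact ⟨hx, by rw [h1, ← hx]⟩
      · rintro ⟨h1, h2⟩
        rw [← h1] at h2
        rw [eq_div_iff hnm] at h1
        exact ⟨h2, by linear_combination h2 + h1⟩

/-- **Faber's incidence formula.** For a Kakeya set `K = ⋃ d, L d` in `AG(2,q)`,
`|K| = q(q+1)/2 + ∑_{A ∈ K} (m_A - 1)(m_A - 2)/2`, where `m_A` is the number of
directions `d` with `A ∈ L d` (stated here multiplied by 2, over `ℤ`). -/
theorem kakeya_incidence_formula {F : Type*} [Field F] [Fintype F] (q : ℕ)
    (hq : Fintype.card F = q) (hq2 : 2 < q)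
    (L : Option F → Set (F × F)) (hL : ∀ d, IsLineWithDir d (L d))
    (K : Set (F × F)) (hK : K = ⋃ d, L d) :
    2 * (K.ncard : ℤ) = q * (q + 1) +
      ∑ A ∈ (Set.toFinite K).toFinset,
        ((Nat.card {d : Option F // A ∈ L d} : ℤ) - 1) *
          ((Nat.card {d : Option F // A ∈ L d} : ℤ) - 2) := by
  classical
  set f : Option F → F × F → ℤ := fun d A => if A ∈ L d then 1 else 0 with hf
  have hm : ∀ A, (Nat.card {d : Option F // A ∈ L d} : ℤ) = ∑ d, f d A := by
    intro A
    rw [Nat.card_eq_fintype_card, Fintype.card_subtype]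
    simp [hf]
  have hnc : ∀ (S : Set (F × F)) [DecidablePred (· ∈ S)], ∑ A, (if A ∈ S then (1 : ℤ) else 0) = S.ncard := by
    intro S _
    rw [Set.ncard_eq_toFinset_card']
    simp
  have h1 : ∀ d, ∑ A, f d A = q := by
    intro d
    rw [hnc, aux_card_line d _ (hL d), hq]
  have h2 : ∀ d e, ∑ A, f d A * f e A = if d = e then (q : ℤ) else 1 := by
    intro d e
    have : ∀ A, f d A * f e A = if A ∈ L d ∩ L e then (1 : ℤ) else 0 := by
      intro A
      by_cases ha : A ∈ L d <;> by_cases hb : A ∈ L e <;> simp [hf, ha, hb]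
    simp only [this]
    rw [hnc]
    split_ifs with hde
    · subst hde
      rw [Set.inter_self, aux_card_line d _ (hL d), hq]
    · rw [aux_inter d e hde _ _ (hL d) (hL e)]; simp
  have hcard : (Fintype.card (Option F) : ℤ) = q + 1 := by
    rw [Fintype.card_option, hq]; push_cast; ring
  have s1 : ∑ A, ∑ d, f d A = (q + 1) * (q : ℤ) := by
    rw [Finset.sum_comm]
    simp only [h1, Finset.sum_const, Finset.card_univ, nsmul_eq_mul, hcard]
  have s2 : ∑ A, (∑ d, f d A) * (∑ d, f d A) = (q + 1) * (2 * (q : ℤ)) := by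
    simp only [Finset.sum_mul_sum]
    rw [Finset.sum_comm]
    have : ∀ d, ∑ A, ∑ e, f d A * f e A = 2 * (q : ℤ) := by
      intro d
      rw [Finset.sum_comm]
      simp only [h2]
      have : ∀ e, (if d = e then (q : ℤ) else 1) = (if d = e then (q : ℤ) - 1 else 0) + 1 := by
        intro e; split_ifs <;> ring
      simp only [this, Finset.sum_add_distrib, Finset.sum_ite_eq, Finset.mem_univ, if_true,
        Finset.sum_const, Finset.card_univ, nsmul_eq_mul, hcard]
      ring
    simp only [this, Finset.sum_const, Finset.card_univ, nsmul_eq_mul, hcard]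
  have hz : ∀ A, A ∉ K → ∑ d, f d A = 0 := by
    intro A hA
    apply Finset.sum_eq_zero
    intro d _
    have : A ∉ L d := fun h => hA (hK ▸ Set.mem_iUnion.2 ⟨d, h⟩)
    simp [hf, this]
  have key : ∑ A ∈ (Set.toFinite K).toFinset,
      ((∑ d, f d A) - 1) * ((∑ d, f d A) - 2) =
      ∑ A, ((∑ d, f d A) * (∑ d, f d A) - 3 * (∑ d, f d A) +
        2 * (if A ∈ K then (1 : ℤ) else 0)) := by
    rw [← Finset.sum_subset (Finset.subset_univ (Set.toFinite K).toFinset)]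
    · apply Finset.sum_congr rfl
      intro A hA
      rw [if_pos ((Set.Finite.mem_toFinset _).1 hA)]
      ring
    · intro A _ hA
      have hA' : A ∉ K := fun h => hA ((Set.Finite.mem_toFinset _).2 h)
      rw [if_neg hA', hz A hA']
      ring
  simp only [hm]
  rw [key, Finset.sum_add_distrib, Finset.sum_sub_distrib, ← Finset.mul_sum, ← Finset.mul_sum,
    s1, s2, hnc]
  ring
end

section
/- (Triple point lemma) Let q be an odd prime power and let K = ⋃_d L_d be a Kakeya set in AG(2,q) with defining lines L_d. Then for every direction d, except possibly one, there exists a point A ∈ L_d with m_A ≥ 3, i.e., A lies on at least three of the defining lines. -/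
lemma kk_prod {F : Type*} [Field F] [Fintype F] [DecidableEq F] (h : F → F)
    (hi : Function.Injective h) (a : F) (ha : h a = 0) :
    ∏ m ∈ Finset.univ.erase a, h m = -1 := by
  have h1 : ∏ m ∈ Finset.univ.erase a, h m = ∏ x ∈ Finset.univ.erase (0 : F), x := by
    have himg : (Finset.univ.erase a).image h = Finset.univ.erase (0 : F) := by
      rw [Finset.image_erase hi, ha, Finset.image_univ_of_surjective
        (Finite.injective_iff_surjective.mp hi)]
    rw [← himg, Finset.prod_image (fun x _ y _ e => hi e)]
  rw [h1]
  have h2 := FiniteField.prod_univ_units_id_eq_neg_one (K := F)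
  have h3 := congrArg (Units.val) h2
  rw [Units.coe_prod] at h3
  rw [Units.val_neg, Units.val_one] at h3
  rw [← h3]
  symm
  refine Finset.prod_bij (fun u _ => (u : F)) ?_ ?_ ?_ ?_
  · intro u _; simp
  · intro u _ v _ e; exact Units.ext e
  · intro b hb
    exact ⟨Units.mk0 b (by simpa using hb), by simp, rfl⟩
  · intro u _; rfl

lemma kk_prod_mul {F : Type*} [Field F] [Fintype F] [DecidableEq F] (h : F → F)
    (hi : Function.Injective h) (a : F) (ha : h a = 0) :
    ∏ m ∈ Finset.univ.erase a, (h m * (m - a)) = 1 := by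
  rw [Finset.prod_mul_distrib, kk_prod h hi a ha,
    kk_prod (fun m => m - a) (fun x y e => by simpa using e) a (by simp)]
  ring

lemma kk_notriple {F : Type*} [Finite F] (L : Option F → Set (F × F)) (d : Option F)
    (hd : ¬ ∃ A ∈ L d, 3 ≤ Nat.card {d' : Option F // A ∈ L d'})
    (A : F × F) (hA : A ∈ L d) (d1 d2 : Option F) (h1 : A ∈ L d1) (h2 : A ∈ L d2)
    (n1 : d1 ≠ d) (n2 : d2 ≠ d) : d1 = d2 := by
  by_contra hne
  apply hd
  refine ⟨A, hA, ?_⟩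
  have : Function.Injective (![⟨d, hA⟩, ⟨d1, h1⟩, ⟨d2, h2⟩] :
      Fin 3 → {d' : Option F // A ∈ L d'}) := by
    intro i j hij
    fin_cases i <;> fin_cases j <;> simp_all [eq_comm]
  simpa using Nat.card_le_card_of_injective _ this

/-- Half of the computation when both bad directions are non-vertical. -/
lemma kk_half {F : Type*} [Field F] [Fintype F] [DecidableEq F]
    (L : Option F → Set (F × F)) (c : F) (b : F → F)
    (hn : L none = {p : F × F | p.1 = c})
    (hs : ∀ m, L (some m) = {p : F × F | p.2 = m * p.1 + b m})
    (m1 m2 x0 : F) (hm : m1 ≠ m2) (hx : m1 * x0 + b m1 = m2 * x0 + b m2)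
    (hd : ¬ ∃ A ∈ L (some m1), 3 ≤ Nat.card {d' : Option F // A ∈ L d'}) :
    (c - x0) * (m2 - m1) *
      ∏ m ∈ (Finset.univ.erase m1).erase m2, (m1 * x0 + b m1 - (m * x0 + b m)) = 1 := by
  let X : F → F := fun m => if m = m1 then x0 else if m = m2 then c else
    (b m1 - b m) / (m - m1)
  let σ : F → Option F := fun m => if m = m1 then some m2 else if m = m2 then none else some m
  have hσ : ∀ m, σ m ≠ some m1 := by
    intro m; simp only [σ]; split_ifs <;> simp_all [eq_comm]
  have hσi : Function.Injective σ := by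
    intro m m' h; simp only [σ] at h; split_ifs at h <;> simp_all
  have hX : ∀ m, (X m, m1 * X m + b m1) ∈ L (σ m) := by
    intro m
    simp only [X, σ]
    split_ifs with h1 h2
    · rw [hs]; simpa using hx
    · rw [hn]; simp
    · rw [hs]
      have : m - m1 ≠ 0 := sub_ne_zero.mpr h1
      simp only [Set.mem_ofPred_eq]
      field_simp
      ring
  have hXi : Function.Injective (fun m => X m - x0) := by
    intro m m' h
    have h' : X m = X m' := by simpa using h
    apply hσi
    refine kk_notriple L (some m1) hd (X m, m1 * X m + b m1) ?_ _ _ (hX m) ?_ (hσ m) (hσ m')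
    · rw [hs]; simp
    · rw [h']; exact hX m'
  have key := kk_prod_mul _ hXi m1 (by simp [X])
  rw [← Finset.mul_prod_erase _ _ (show m2 ∈ Finset.univ.erase m1 by simp [hm.symm])] at key
  rw [← key]
  congr 1
  · simp [X, hm.symm]
  · apply Finset.prod_congr rfl
    intro m hmm
    simp only [Finset.mem_erase, Finset.mem_univ, and_true] at hmm
    have : m - m1 ≠ 0 := sub_ne_zero.mpr hmm.2
    simp only [X, hmm.1, hmm.2, if_false]
    field_simp
    ring

theorem kakeya_triple_point_lemma {F : Type*} [Field F] [Fintype F] (q : ℕ)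
    (hq : Fintype.card F = q) (hodd : Odd q)
    (L : Option F → Set (F × F)) (hL : ∀ d, IsLineWithDir d (L d)) :
    ∃ d₀ : Option F, ∀ d : Option F, d ≠ d₀ →
      ∃ A ∈ L d, 3 ≤ Nat.card {d' : Option F // A ∈ L d'} := by
  classical
  have two : (2 : F) ≠ 0 := by
    apply Ring.two_ne_zero
    intro h
    have := FiniteField.even_card_iff_char_two.mp h
    rw [hq] at this
    rcases hodd with ⟨k, hk⟩
    omega
  obtain ⟨c, hn⟩ : ∃ c : F, L none = {p : F × F | p.1 = c} := hL none
  have hs' : ∀ m : F, ∃ b : F, L (some m) = {p : F × F | p.2 = m * p.1 + b} :=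
    fun m => hL (some m)
  choose b hs using hs'
  by_contra hcon
  have hcon' : ∀ d₀ : Option F, ∃ d, d ≠ d₀ ∧
      ¬ ∃ A ∈ L d, 3 ≤ Nat.card {d' : Option F // A ∈ L d'} := by
    intro d₀
    by_contra h
    exact hcon ⟨d₀, fun d hd => by
      by_contra h2
      exact h ⟨d, hd, h2⟩⟩
  obtain ⟨d, hdn, hd⟩ := hcon' none
  obtain ⟨m1, rfl⟩ := Option.ne_none_iff_exists'.mp hdn
  obtain ⟨e, hem, he⟩ := hcon' (some m1)
  cases e with
  | none =>
    -- value on the vertical line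
    have hBi : Function.Injective (fun m => (m1 * c + b m1) - (m * c + b m)) := by
      intro m m' h
      have h' : m * c + b m = m' * c + b m' := by simpa using h
      have := kk_notriple L none he (c, m * c + b m) (by rw [hn]; simp) (some m) (some m')
        (by rw [hs]; simp) (by rw [hs]; simpa using h') (by simp) (by simp)
      simpa using this
    let X : F → F := fun m => if m = m1 then c else (b m1 - b m) / (m - m1)
    let σ : F → Option F := fun m => if m = m1 then none else some m
    have hσ : ∀ m, σ m ≠ some m1 := by
      intro m; simp only [σ]; split_ifs <;> simp_all
    have hσi : Function.Injective σ := by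
      intro m m' h; simp only [σ] at h; split_ifs at h <;> simp_all
    have hX : ∀ m, (X m, m1 * X m + b m1) ∈ L (σ m) := by
      intro m
      simp only [X, σ]
      split_ifs with h1
      · rw [hn]; simp
      · rw [hs]
        have : m - m1 ≠ 0 := sub_ne_zero.mpr h1
        simp only [Set.mem_ofPred_eq]
        field_simp
        ring
    have hXi : Function.Injective (fun m => X m - c) := by
      intro m m' h
      have h' : X m = X m' := by simpa using h
      apply hσi
      refine kk_notriple L (some m1) hd (X m, m1 * X m + b m1) ?_ _ _ (hX m) ?_ (hσ m) (hσ m')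
      · rw [hs]; simp
      · rw [h']; exact hX m'
    have k1 := kk_prod_mul _ hXi m1 (by simp [X])
    have k2 := kk_prod _ hBi m1 (by simp)
    have k3 : (1 : F) = -1 := by
      rw [← k2, ← k1]
      apply Finset.prod_congr rfl
      intro m hmm
      simp only [Finset.mem_erase, Finset.mem_univ, and_true] at hmm
      have : m - m1 ≠ 0 := sub_ne_zero.mpr hmm
      simp only [X, hmm, if_false]
      field_simp
      ring
    apply two
    linear_combination k3
  | some m2 =>
    have hm : m1 ≠ m2 := fun h => hem (by rw [h])
    have hm' : m1 - m2 ≠ 0 := sub_ne_zero.mpr hm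
    have hx : m1 * ((b m2 - b m1) / (m1 - m2)) + b m1
        = m2 * ((b m2 - b m1) / (m1 - m2)) + b m2 := by
      field_simp
      ring
    have k1 := kk_half L c b hn hs m1 m2 _ hm hx hd
    have k2 := kk_half L c b hn hs m2 m1 _ hm.symm hx.symm he
    rw [Finset.erase_right_comm, ← hx] at k2
    apply two
    linear_combination -k1 - k2
end

section
/- Let q be an odd prime power. Every Kakeya set K in AG(2,q) satisfies |K| ≥ q(q+1)/2 + q/3, i.e., 6·|K| ≥ 3q(q+1) + 2q. -/
namespace KFB

/-- An injective nonvanishing function on a set of size `q - 1` has product `-1`. -/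
lemma prod_inj {F ι : Type*} [Field F] [Fintype F] [DecidableEq ι] (S : Finset ι)
    (hS : S.card + 1 = Fintype.card F) (f : ι → F) (h0 : ∀ i ∈ S, f i ≠ 0)
    (hinj : ∀ i ∈ S, ∀ j ∈ S, f i = f j → i = j) : ∏ i ∈ S, f i = -1 := by
  classical
  have h1 : S.image f = Finset.univ.erase (0 : F) := by
    apply Finset.eq_of_subset_of_card_le
    · intro x hx
      obtain ⟨i, hi, rfl⟩ := Finset.mem_image.1 hx
      simp [h0 i hi]
    · rw [Finset.card_image_of_injOn (fun i hi j hj h => hinj i hi j hj h),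
        Finset.card_erase_of_mem (Finset.mem_univ _), Finset.card_univ]
      omega
  have h2 : ∏ x ∈ S.image f, x = ∏ i ∈ S, f i :=
    Finset.prod_image (fun i hi j hj h => hinj i hi j hj h)
  rw [← h2, h1]
  have h3 := FiniteField.prod_univ_units_id_eq_neg_one (K := F)
  have h4 := congrArg (Units.val) h3
  rw [Units.coe_prod] at h4
  simp only [Units.val_neg, Units.val_one] at h4
  rw [← h4]
  symm
  refine Finset.prod_bij (fun u _ => (u : F)) ?_ ?_ ?_ ?_
  · intro u _; simp
  · intro u _ v _ h; exact Units.ext h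
  · intro x hx
    have : x ≠ 0 := by simpa using hx
    exact ⟨Units.mk0 x this, Finset.mem_univ _, rfl⟩
  · intro u _; rfl

/-- Two lines cannot both avoid all triple points. -/
lemma two_nuclei {F ι : Type*} [Field F] [Fintype F] [Fintype ι] [DecidableEq ι]
    (hodd : Odd (Fintype.card F)) (hι : Fintype.card ι = Fintype.card F + 1)
    (A B C : ι → F) (hD : ∀ i j, i ≠ j → A i * B j - A j * B i ≠ 0) (d e : ι) (hde : d ≠ e)
    (T : ι → ι → ι → F)
    (hT : ∀ i j k, T i j k = A i * (B j * C k - B k * C j) - B i * (A j * C k - A k * C j)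
      + C i * (A j * B k - A k * B j))
    (hd : ∀ f g, f ≠ d → g ≠ d → f ≠ g → T d f g ≠ 0)
    (he : ∀ f g, f ≠ e → g ≠ e → f ≠ g → T e f g ≠ 0) : False := by
  set S : Finset ι := (Finset.univ.erase d).erase e with hSdef
  have hS : S.card + 1 = Fintype.card F := by
    have h1 : e ∈ Finset.univ.erase d := by simp [hde.symm]
    have h2 := Finset.card_erase_add_one h1
    rw [← hSdef] at h2
    have h3 := Finset.card_erase_add_one (Finset.mem_univ d)
    rw [Finset.card_univ] at h3
    omega
  have hmem : ∀ f ∈ S, f ≠ d ∧ f ≠ e := by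
    intro f hf
    simp [hSdef] at hf
    tauto
  have hW := prod_inj S hS (fun f => T d e f / (A d * B f - A f * B d))
    (fun f hf => div_ne_zero (hd e f hde.symm (hmem f hf).1 (hmem f hf).2.symm)
      (hD d f (hmem f hf).1.symm)) (by
      intro f hf g hg h
      by_contra hfg
      have h1 := hD d f (hmem f hf).1.symm
      have h2 := hD d g (hmem g hg).1.symm
      rw [div_eq_div_iff h1 h2] at h
      have h3 : T d f g * (A d * B e - A e * B d) = 0 := by
        simp only [hT] at h ⊢
        linear_combination -h
      rcases mul_eq_zero.1 h3 with h4 | h4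
      · exact hd f g (hmem f hf).1 (hmem g hg).1 hfg h4
      · exact hD d e hde h4)
  have hV := prod_inj S hS (fun f => T d e f / (A e * B f - A f * B e))
    (fun f hf => div_ne_zero (hd e f hde.symm (hmem f hf).1 (hmem f hf).2.symm)
      (hD e f (hmem f hf).2.symm)) (by
      intro f hf g hg h
      by_contra hfg
      have h1 := hD e f (hmem f hf).2.symm
      have h2 := hD e g (hmem g hg).2.symm
      rw [div_eq_div_iff h1 h2] at h
      have h3 : T e f g * (A d * B e - A e * B d) = 0 := by
        simp only [hT] at h ⊢
        linear_combination -h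
      rcases mul_eq_zero.1 h3 with h4 | h4
      · exact he f g (hmem f hf).2 (hmem g hg).2 hfg h4
      · exact hD d e hde h4)
  have hR := prod_inj S hS (fun f => (A d * B f - A f * B d) / (A e * B f - A f * B e))
    (fun f hf => div_ne_zero (hD d f (hmem f hf).1.symm)
      (hD e f (hmem f hf).2.symm)) (by
      intro f hf g hg h
      by_contra hfg
      have h1 := hD e f (hmem f hf).2.symm
      have h2 := hD e g (hmem g hg).2.symm
      rw [div_eq_div_iff h1 h2] at h
      have h3 : (A f * B g - A g * B f) * (A d * B e - A e * B d) = 0 := by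
        linear_combination h
      rcases mul_eq_zero.1 h3 with h4 | h4
      · exact hD f g hfg h4
      · exact hD d e hde h4)
  have h5 : ∏ f ∈ S, T d e f / (A e * B f - A f * B e) =
      (∏ f ∈ S, T d e f / (A d * B f - A f * B d)) *
      ∏ f ∈ S, (A d * B f - A f * B d) / (A e * B f - A f * B e) := by
    rw [← Finset.prod_mul_distrib]
    refine Finset.prod_congr rfl fun f hf => ?_
    have h1 := hD e f (hmem f hf).2.symm
    have h2 := hD d f (hmem f hf).1.symm
    rw [div_mul_div_cancel₀ h2]
  rw [hW, hV, hR] at h5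
  have h2 : (-1 : F) ≠ 1 := by
    apply Ring.neg_one_ne_one_of_char_ne_two
    intro hc
    have := FiniteField.even_card_of_char_two hc
    rw [Nat.odd_iff] at hodd
    omega
  exact h2 (by rw [h5]; ring)

/-- The pointwise estimate. -/
lemma pointwise (m : ℕ) : (9 : ℤ) * m - 3 * m ^ 2 + 2 * (if 3 ≤ m then (m : ℤ) else 0)
    ≤ 6 * (if 1 ≤ m then 1 else 0) := by
  rcases Nat.lt_or_ge m 3 with h | h
  · interval_cases m <;> norm_num
  · rw [if_pos h, if_pos (by omega)]
    have : (3 : ℤ) ≤ m := by exact_mod_cast h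
    nlinarith

lemma count {P ι : Type*} [Fintype P] [DecidableEq P] [Fintype ι] [DecidableEq ι] (q : ℕ)
    (hι : Fintype.card ι = q + 1) (M : ι → Finset P) (hM : ∀ i, (M i).card = q)
    (hMM : ∀ i j, i ≠ j → (M i ∩ M j).card = 1)
    (d0 : ι) (ht : ∀ d, d ≠ d0 → ∃ p ∈ M d, 3 ≤ (Finset.univ.filter fun i => p ∈ M i).card) :
    3 * q * (q + 1) + 2 * q ≤ 6 * (Finset.univ.biUnion M).card := by
  set m : P → ℕ := fun p => (Finset.univ.filter fun i => p ∈ M i).card with hm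
  have hmsum : ∀ p, (m p : ℤ) = ∑ i, if p ∈ M i then 1 else 0 := by
    intro p; simp [hm]
  have s1 : ∑ p, (m p : ℤ) = q * (q + 1) := by
    simp_rw [hmsum]
    rw [Finset.sum_comm]
    simp [hM, hι]; ring
  have s2 : ∑ p, (m p : ℤ) ^ 2 = 2 * (q * (q + 1)) := by
    have e1 : ∀ p, (m p : ℤ) ^ 2 = ∑ i, ∑ j, if p ∈ M i ∩ M j then 1 else 0 := by
      intro p
      rw [sq, hmsum, Finset.sum_mul_sum]
      refine Finset.sum_congr rfl fun i _ => Finset.sum_congr rfl fun j _ => ?_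
      by_cases h1 : p ∈ M i <;> by_cases h2 : p ∈ M j <;> simp [h1, h2]
    simp_rw [e1]
    rw [Finset.sum_comm]
    have e2 : ∀ i, ∑ p, ∑ j, (if p ∈ M i ∩ M j then (1 : ℤ) else 0) = 2 * q := by
      intro i
      rw [Finset.sum_comm]
      have e3 : ∀ j, ∑ p, (if p ∈ M i ∩ M j then (1 : ℤ) else 0) = ((M i ∩ M j).card : ℤ) := by
        intro j
        rw [Finset.sum_boole, Finset.filter_univ_mem]
      simp_rw [e3]
      rw [← Finset.add_sum_erase _ _ (Finset.mem_univ i), Finset.inter_self, hM,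
        Finset.sum_congr rfl (g := fun _ => (1 : ℤ))]
      · rw [Finset.sum_const, Finset.card_erase_of_mem (Finset.mem_univ _), Finset.card_univ, hι]
        simp; ring
      · intro j hj
        rw [hMM i j (Finset.ne_of_mem_erase hj).symm]; rfl
    simp_rw [e2]
    rw [Finset.sum_const, Finset.card_univ, hι]
    simp; ring
  have s3 : (q : ℤ) ≤ ∑ p, (if 3 ≤ m p then (m p : ℤ) else 0) := by
    have e1 : ∀ p, (if 3 ≤ m p then (m p : ℤ) else 0)
        = ∑ i, if p ∈ M i ∧ 3 ≤ m p then 1 else 0 := by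
      intro p
      by_cases h : 3 ≤ m p
      · simp only [h, and_true, if_true]; exact hmsum p
      · simp [h]
    simp_rw [e1]
    rw [Finset.sum_comm]
    have e2 : (q : ℤ) = ∑ i ∈ Finset.univ.erase d0, 1 := by
      rw [Finset.sum_const, Finset.card_erase_of_mem (Finset.mem_univ _), Finset.card_univ, hι]
      simp
    rw [e2]
    refine le_trans (Finset.sum_le_sum (fun i hi => ?_)) (Finset.sum_le_sum_of_subset_of_nonneg
      (Finset.erase_subset d0 Finset.univ) ?_)
    · obtain ⟨p, hp, hp3⟩ := ht i (Finset.ne_of_mem_erase hi)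
      have := Finset.single_le_sum (f := fun p => if p ∈ M i ∧ 3 ≤ m p then (1 : ℤ) else 0)
        (fun p _ => by split_ifs <;> norm_num) (Finset.mem_univ p)
      rw [if_pos ⟨hp, hp3⟩] at this
      exact this
    · intro i _ _
      exact Finset.sum_nonneg fun p _ => by split_ifs <;> norm_num
  have s4 : ((Finset.univ.biUnion M).card : ℤ) = ∑ p, (if 1 ≤ m p then 1 else 0) := by
    rw [Finset.sum_boole]
    congr 2
    ext p
    simp [hm, Finset.one_le_card, Finset.Nonempty]
  have s5 := Finset.sum_le_sum (s := Finset.univ) (fun p _ => pointwise (m p))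
  rw [Finset.sum_add_distrib, Finset.sum_sub_distrib, ← Finset.mul_sum, ← Finset.mul_sum,
    ← Finset.mul_sum, ← Finset.mul_sum, ← s4, s1, s2] at s5
  zify
  linarith

end KFB

/-- **Faber.** For `q` an odd prime power, every Kakeya set `K` in `AG(2,q)`
satisfies `|K| ≥ q(q+1)/2 + q/3`, i.e. `6|K| ≥ 3q(q+1) + 2q`. -/
theorem kakeya_faber_bound {F : Type*} [Field F] [Fintype F] (q : ℕ)
    (hq : Fintype.card F = q) (hodd : Odd q)
    (L : Option F → Set (F × F)) (hL : ∀ d, IsLineWithDir d (L d))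
    (K : Set (F × F)) (hK : K = ⋃ d, L d) :
    3 * q * (q + 1) + 2 * q ≤ 6 * K.ncard := by
  classical
  let A : Option F → F := fun d => d.elim 1 (fun m => -m)
  let B : Option F → F := fun d => d.elim 0 (fun _ => 1)
  have hC : ∀ d, ∃ c, ∀ p, p ∈ L d ↔ A d * p.1 + B d * p.2 = c := by
    intro d
    cases d with
    | none =>
      obtain ⟨c, hc⟩ := hL none
      exact ⟨c, fun p => by simp [hc, A, B]⟩
    | some m =>
      obtain ⟨c, hc⟩ := hL (some m)
      refine ⟨c, fun p => ?_⟩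
      simp only [hc, A, B, Set.mem_ofPred_eq, Option.elim]
      constructor <;> intro h <;> linear_combination h
  choose C hC using hC
  have hD : ∀ i j, i ≠ j → A i * B j - A j * B i ≠ 0 := by
    intro i j hij
    cases i <;> cases j
    · exact absurd rfl hij
    · simp [A, B]
    · simp [A, B]
    · rename_i a b
      simp only [A, B, Option.elim]
      intro h
      exact hij (congrArg some (by linear_combination -h))
  have hcardL : ∀ d, (L d).toFinset.card = q := by
    intro d
    rw [← hq, ← Finset.card_univ]
    symm
    cases d with
    | none =>
      refine Finset.card_bij (fun y _ => (C none, y)) ?_ ?_ ?_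
      · intro y _; simp [hC, A, B]
      · intro y _ z _ h; exact (Prod.ext_iff.1 h).2
      · rintro ⟨x, y⟩ h
        simp [hC, A, B] at h
        exact ⟨y, Finset.mem_univ _, by simp [h]⟩
    | some m =>
      refine Finset.card_bij (fun x _ => (x, m * x + C (some m))) ?_ ?_ ?_
      · intro y _; simp [hC, A, B]
      · intro y _ z _ h; exact (Prod.ext_iff.1 h).1
      · rintro ⟨x, y⟩ h
        simp [hC, A, B] at h
        exact ⟨x, Finset.mem_univ _, by rw [← h]; ext <;> simp⟩
  let X : Option F → Option F → F × F := fun i j =>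
    ((C i * B j - C j * B i) / (A i * B j - A j * B i),
      (A i * C j - A j * C i) / (A i * B j - A j * B i))
  have hX1 : ∀ i j, i ≠ j → X i j ∈ L i := by
    intro i j hij
    have := hD i j hij
    rw [hC]; simp only [X]
    rw [← mul_div_assoc, ← mul_div_assoc, ← add_div, div_eq_iff this]; ring
  have hX2 : ∀ i j, i ≠ j → X i j ∈ L j := by
    intro i j hij
    have := hD i j hij
    rw [hC]; simp only [X]
    rw [← mul_div_assoc, ← mul_div_assoc, ← add_div, div_eq_iff this]; ring
  have hmeet : ∀ i j, i ≠ j → ((L i).toFinset ∩ (L j).toFinset).card = 1 := by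
    intro i j hij
    rw [Finset.card_eq_one]
    refine ⟨X i j, ?_⟩
    ext p
    simp only [Finset.mem_inter, Set.mem_toFinset, Finset.mem_singleton]
    constructor
    · rintro ⟨h1, h2⟩
      rw [hC] at h1 h2
      have := hD i j hij
      ext
      · simp only [X]; rw [eq_div_iff this, ← h1, ← h2]; ring
      · simp only [X]; rw [eq_div_iff this, ← h1, ← h2]; ring
    · rintro rfl
      exact ⟨hX1 i j hij, hX2 i j hij⟩
  have hι : Fintype.card (Option F) = Fintype.card F + 1 := Fintype.card_option
  have htrip : ∀ d, (¬ ∃ p ∈ (L d).toFinset,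
      3 ≤ (Finset.univ.filter fun i => p ∈ (L i).toFinset).card) →
      ∀ f g, f ≠ d → g ≠ d → f ≠ g →
      A d * (B f * C g - B g * C f) - B d * (A f * C g - A g * C f)
      + C d * (A f * B g - A g * B f) ≠ 0 := by
    intro d hno f g hf hg hfg h0
    apply hno
    have hdf := hD d f hf.symm
    refine ⟨X d f, by simpa using hX1 d f hf.symm, ?_⟩
    have hg' : X d f ∈ L g := by
      rw [hC]; simp only [X]
      rw [← mul_div_assoc, ← mul_div_assoc, ← add_div, div_eq_iff hdf]
      linear_combination -h0
    have hsub : ({d, f, g} : Finset (Option F)) ⊆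
        Finset.univ.filter fun i => X d f ∈ (L i).toFinset := by
      intro i hi
      simp only [Finset.mem_insert, Finset.mem_singleton] at hi
      simp only [Finset.mem_filter, Finset.mem_univ, true_and, Set.mem_toFinset]
      rcases hi with rfl | rfl | rfl
      · exact hX1 _ _ hf.symm
      · exact hX2 _ _ hf.symm
      · exact hg'
    have hc := Finset.card_le_card hsub
    rwa [Finset.card_eq_three.2 ⟨d, f, g, hf.symm, hg.symm, hfg, rfl⟩] at hc
  have hd0 : ∃ d0, ∀ d, d ≠ d0 → ∃ p ∈ (L d).toFinset,
      3 ≤ (Finset.univ.filter fun i => p ∈ (L i).toFinset).card := by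
    by_contra hcon
    push Not at hcon
    obtain ⟨d, -, hd⟩ := hcon none
    obtain ⟨e, hed, he⟩ := hcon d
    refine KFB.two_nuclei (hq ▸ hodd) hι A B C hD d e hed.symm _ (fun _ _ _ => rfl)
      (htrip d ?_) (htrip e ?_)
    · push Not; exact hd
    · push Not; exact he
  obtain ⟨d0, hd0⟩ := hd0
  have hfin := KFB.count q (by rw [hι, hq]) (fun d => (L d).toFinset) hcardL hmeet d0 hd0
  have hKc : K.ncard = (Finset.univ.biUnion fun d => (L d).toFinset).card := by
    rw [← Set.ncard_coe_finset]
    congr 1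
    rw [hK]; ext p; simp
  rw [hKc]
  exact hfin
end

section
/- Let q be an odd prime power. Every Kakeya set K in AG(2,q) satisfies |K| ≥ q(q+1)/2 + 5q/14 − 1/14, i.e., 14·|K| ≥ 7q(q+1) + 5q − 1. -/
section KakeyaHelpers

open Finset Classical

variable {F : Type*} [Field F]

/-- first coefficient of the normal form of lines with direction `d` -/
def kA (d : Option F) : F := match d with
  | none => 1
  | some m => m

/-- second coefficient of the normal form of lines with direction `d` -/
def kB (d : Option F) : F := match d with
  | none => 0
  | some _ => -1

theorem kdet_ne {d e : Option F} (h : d ≠ e) : kA d * kB e - kA e * kB d ≠ 0 := by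
  rcases d with _ | m <;> rcases e with _ | n
  · exact absurd rfl h
  · simp [kA, kB]
  · simp [kA, kB]
  · intro h0
    apply h
    simp only [kA, kB] at h0
    congr 1
    linear_combination -h0

theorem exists_kdir (a b : F) (h : ¬ (a = 0 ∧ b = 0)) :
    ∃ (d : Option F) (s : F), s ≠ 0 ∧ a = s * kA d ∧ b = s * kB d := by
  by_cases hb : b = 0
  · exact ⟨none, a, fun ha => h ⟨ha, hb⟩, by simp [kA], by simp [kB, hb]⟩
  · refine ⟨some (-a / b), -b, by simpa using hb, ?_, ?_⟩
    · simp only [kA]; field_simp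
    · simp [kB]

theorem cramer_unique {a b c a' b' c' : F} (h : a * b' - a' * b ≠ 0) (p : F × F) :
    (a * p.1 + b * p.2 + c = 0 ∧ a' * p.1 + b' * p.2 + c' = 0) ↔
      p = ((b * c' - b' * c) / (a * b' - a' * b), (a' * c - a * c') / (a * b' - a' * b)) := by
  obtain ⟨x, y⟩ := p
  simp only [Prod.mk.injEq]
  constructor
  · rintro ⟨h1, h2⟩
    rw [eq_div_iff h, eq_div_iff h]
    constructor
    · linear_combination b' * h1 - b * h2
    · linear_combination a * h2 - a' * h1
  · rintro ⟨h1, h2⟩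
    rw [eq_div_iff h] at h1 h2
    constructor
    · apply mul_right_cancel₀ h
      linear_combination a * h1 + b * h2
    · apply mul_right_cancel₀ h
      linear_combination a' * h1 + b' * h2

variable [Fintype F]

/-- the line with direction `d` and constant term `c` -/
noncomputable def kln (d : Option F) (c : F) : Finset (F × F) :=
  univ.filter fun p => kA d * p.1 + kB d * p.2 + c = 0

theorem mem_kln {d : Option F} {c : F} {p : F × F} :
    p ∈ kln d c ↔ kA d * p.1 + kB d * p.2 + c = 0 := by simp [kln]

theorem card_kln (d : Option F) (c : F) : (kln d c).card = Fintype.card F := by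
  rcases d with _ | m
  · have : kln none c = (univ : Finset F).image (fun y => (-c, y)) := by
      ext ⟨x, y⟩
      simp only [mem_kln, kA, kB, mem_image, mem_univ, true_and, Prod.mk.injEq, exists_eq_right]
      constructor
      · intro h; linear_combination -h
      · rintro rfl; ring
    rw [this, card_image_of_injective _ (fun a b h => by simpa using h), card_univ]
  · have : kln (some m) c = (univ : Finset F).image (fun x => (x, m * x + c)) := by
      ext ⟨x, y⟩
      simp only [mem_kln, kA, kB, mem_image, mem_univ, true_and, Prod.mk.injEq]
      constructor
      · intro h; exact ⟨x, rfl, by linear_combination h⟩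
      · rintro ⟨_, rfl, rfl⟩; ring
    rw [this, card_image_of_injective _ (fun a b h => by simp at h; exact h.1), card_univ]

theorem card_inter_kln {d e : Option F} (h : d ≠ e) (c c' : F) :
    (kln d c ∩ kln e c').card = 1 := by
  rw [card_eq_one]
  refine ⟨((kB d * c' - kB e * c) / (kA d * kB e - kA e * kB d),
    (kA e * c - kA d * c') / (kA d * kB e - kA e * kB d)), ?_⟩
  ext p
  rw [mem_inter, mem_kln, mem_kln, cramer_unique (kdet_ne h), mem_singleton]

theorem inter_kln_par (d : Option F) {c c' : F} (h : c ≠ c') :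
    kln d c ∩ kln d c' = ∅ := by
  ext p
  simp only [mem_inter, mem_kln, notMem_empty, iff_false]
  rintro ⟨h1, h2⟩
  exact h (by linear_combination h1 - h2)

/-- multiplicity of a point -/
noncomputable def kmul (C : Option F → F) (p : F × F) : ℕ :=
  (univ.filter fun d => p ∈ kln d (C d)).card

theorem sum_kmul (C : Option F → F) (s : Finset (F × F)) :
    ∑ p ∈ s, kmul C p = ∑ d, (s ∩ kln d (C d)).card := by
  simp only [kmul, card_filter]
  rw [sum_comm]
  refine sum_congr rfl fun d _ => ?_
  rw [← card_filter, filter_mem_eq_inter]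

theorem sum_kmul_kln (C : Option F → F) (d : Option F) :
    ∑ p ∈ kln d (C d), kmul C p = 2 * Fintype.card F := by
  rw [sum_kmul, ← add_sum_erase _ _ (mem_univ d), inter_self, card_kln,
    sum_congr rfl (g := fun _ => 1) (fun e he => card_inter_kln (ne_of_mem_erase he).symm _ _)]
  simp
  ring

theorem sum_kmul_other (C : Option F → F) (d : Option F) {c : F} (h : c ≠ C d) :
    ∑ p ∈ kln d c, kmul C p = Fintype.card F := by
  rw [sum_kmul, ← add_sum_erase _ _ (mem_univ d), inter_kln_par d h,
    sum_congr rfl (g := fun _ => 1) (fun e he => card_inter_kln (ne_of_mem_erase he).symm _ _)]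
  simp

theorem sum_kmul_univ (C : Option F → F) :
    ∑ p, kmul C p = (Fintype.card F + 1) * Fintype.card F := by
  rw [sum_kmul]
  simp [card_kln]

theorem sum_kmul_sq (C : Option F → F) :
    ∑ p, kmul C p * kmul C p = (Fintype.card F + 1) * (2 * Fintype.card F) := by
  have : ∀ p, kmul C p * kmul C p = ∑ d, if p ∈ kln d (C d) then kmul C p else 0 := by
    intro p
    rw [← sum_filter, sum_const, smul_eq_mul]
    rfl
  simp_rw [this]
  rw [sum_comm]
  have h2 : ∀ d, (∑ p, if p ∈ kln d (C d) then kmul C p else 0) = 2 * Fintype.card F := by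
    intro d
    rw [← sum_kmul_kln C d, ← sum_filter]
    congr 1
    ext p; simp
  simp_rw [h2]
  simp

/-- A line all of whose points have even multiplicity has only double points. -/
theorem kmul_eq_two (C : Option F → F) (d : Option F)
    (h : ∀ p ∈ kln d (C d), Even (kmul C p)) : ∀ p ∈ kln d (C d), kmul C p = 2 := by
  have h2 : ∀ p ∈ kln d (C d), 2 ≤ kmul C p := by
    intro p hp
    have h1 : 0 < kmul C p := card_pos.mpr ⟨d, by simpa using hp⟩
    obtain ⟨k, hk⟩ := h p hp
    omega
  have hs : ∑ p ∈ kln d (C d), 2 = ∑ p ∈ kln d (C d), kmul C p := by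
    rw [sum_kmul_kln, sum_const, card_kln, smul_eq_mul, mul_comm]
  intro p hp
  exact ((sum_eq_sum_iff_of_le h2).mp hs p hp).symm

theorem no_triple (C : Option F → F) (p : F × F) (hp : kmul C p = 2) {d e g : Option F}
    (hd : p ∈ kln d (C d)) (he : p ∈ kln e (C e)) (hg : p ∈ kln g (C g))
    (hde : d ≠ e) (hdg : d ≠ g) (heg : e ≠ g) : False := by
  have : ({d, e, g} : Finset (Option F)) ⊆ univ.filter fun d => p ∈ kln d (C d) := by
    intro x hx
    simp only [mem_insert, mem_singleton] at hx
    rcases hx with rfl | rfl | rfl <;> simpa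
  have h3 := card_le_card this
  rw [card_eq_three.mpr ⟨d, e, g, hde, hdg, heg, rfl⟩] at h3
  unfold kmul at hp
  omega

theorem prod_inj {ι : Type*} [Fintype ι] (f : ι → F) (h0 : ∀ i, f i ≠ 0)
    (hinj : Function.Injective f) (hc : Fintype.card ι + 1 = Fintype.card F) :
    ∏ i, f i = -1 := by
  let u : ι → Fˣ := fun i => Units.mk0 (f i) (h0 i)
  have hu : Function.Injective u := fun i j hij => hinj (by
    have := congrArg Units.val hij
    simpa [u] using this)
  have hb : Function.Bijective u := by
    rw [Fintype.bijective_iff_injective_and_card]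
    refine ⟨hu, ?_⟩
    rw [Fintype.card_units]
    omega
  have h1 : ∏ i, u i = ∏ x : Fˣ, x := hb.prod_comp (fun x => x)
  rw [FiniteField.prod_univ_units_id_eq_neg_one] at h1
  have h2 := congrArg (Units.val) h1
  simpa [u] using h2

/-- At most one defining line has only double points (Bichara–Korchmáros). -/
theorem nucleus_unique (hodd : Odd (Fintype.card F)) (C : Option F → F) {d e : Option F}
    (hd : ∀ p ∈ kln d (C d), kmul C p = 2) (he : ∀ p ∈ kln e (C e), kmul C p = 2) : d = e := by
  by_contra hde
  set D := kA d * kB e - kA e * kB d with hD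
  have hD0 : D ≠ 0 := kdet_ne hde
  let ι := {g : Option F // g ≠ d ∧ g ≠ e}
  have hcard : Fintype.card ι + 1 = Fintype.card F := by
    have h1 : Fintype.card ι = ((univ.erase d).erase e).card := by
      rw [Fintype.card_subtype]
      congr 1
      ext g; simp [and_comm]
    rw [h1, card_erase_of_mem (by simp [Ne.symm hde]), card_erase_of_mem (mem_univ _), card_univ,
      Fintype.card_option]
    have := Fintype.one_lt_card (α := F)
    omega
  -- scaled coordinates: D * f_g = lam g * f_d + mu g * f_e + nu g
  let lam : Option F → F := fun g => kA g * kB e - kA e * kB g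
  let mu : Option F → F := fun g => kA d * kB g - kA g * kB d
  let nu : Option F → F := fun g => D * C g - lam g * C d - mu g * C e
  have hlam : ∀ g : ι, lam g ≠ 0 := fun g => kdet_ne g.2.2
  have hmu : ∀ g : ι, mu g ≠ 0 := fun g => kdet_ne g.2.1.symm
  have key : ∀ (g : Option F) (p : F × F), D * (kA g * p.1 + kB g * p.2 + C g) =
      lam g * (kA d * p.1 + kB d * p.2 + C d) + mu g * (kA e * p.1 + kB e * p.2 + C e) + nu g := by
    intro g p
    simp only [lam, mu, nu, hD]
    ring
  have solve : ∀ s t : F, ∃ p : F × F, kA d * p.1 + kB d * p.2 + C d = s ∧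
      kA e * p.1 + kB e * p.2 + C e = t := by
    intro s t
    obtain ⟨p, h1, h2⟩ : ∃ p : F × F, kA d * p.1 + kB d * p.2 + (C d - s) = 0 ∧
        kA e * p.1 + kB e * p.2 + (C e - t) = 0 := ⟨_, (cramer_unique hD0 _).mpr rfl⟩
    exact ⟨p, by linear_combination h1, by linear_combination h2⟩
  have hnu : ∀ g : ι, nu g ≠ 0 := by
    intro g h0
    obtain ⟨p, h1, h2⟩ := solve 0 0
    have h3 := key g p
    rw [h1, h2, h0] at h3
    have h4 : kA g.1 * p.1 + kB g.1 * p.2 + C g = 0 := by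
      apply mul_left_cancel₀ hD0
      linear_combination h3
    exact no_triple C p (hd p (mem_kln.mpr h1)) (mem_kln.mpr h1) (mem_kln.mpr h2) (mem_kln.mpr h4)
      hde g.2.1.symm g.2.2.symm
  have P1 : ∏ g : ι, lam g / mu g = -1 := by
    apply prod_inj _ (fun g => div_ne_zero (hlam g) (hmu g)) _ hcard
    intro g h hgh
    by_contra hne
    have hW := kdet_ne (fun h' => hne (Subtype.ext h'))
    apply mul_ne_zero hW hD0
    simp only at hgh
    rw [div_eq_div_iff (hmu g) (hmu h)] at hgh
    simp only [lam, mu] at hgh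
    rw [hD]
    linear_combination hgh
  have P2 : ∏ g : ι, (-nu g) / mu g = -1 := by
    apply prod_inj _ (fun g => div_ne_zero (neg_ne_zero.mpr (hnu g)) (hmu g)) _ hcard
    intro g h hgh
    by_contra hne
    obtain ⟨p, h1, h2⟩ := solve 0 (-nu g / mu g)
    have on : ∀ k : ι, -nu g / mu g = -nu k / mu k → kA k.1 * p.1 + kB k.1 * p.2 + C k = 0 := by
      intro k hk
      have h3 := key k p
      rw [h1, h2, hk, mul_div_cancel₀ _ (hmu k)] at h3
      apply mul_left_cancel₀ hD0
      linear_combination h3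
    exact no_triple C p (hd p (mem_kln.mpr h1)) (mem_kln.mpr h1) (mem_kln.mpr (on g rfl))
      (mem_kln.mpr (on h hgh)) g.2.1.symm h.2.1.symm (fun h' => hne (Subtype.ext h'))
  have P3 : ∏ g : ι, (-nu g) / lam g = -1 := by
    apply prod_inj _ (fun g => div_ne_zero (neg_ne_zero.mpr (hnu g)) (hlam g)) _ hcard
    intro g h hgh
    by_contra hne
    obtain ⟨p, h1, h2⟩ := solve (-nu g / lam g) 0
    have on : ∀ k : ι, -nu g / lam g = -nu k / lam k →
        kA k.1 * p.1 + kB k.1 * p.2 + C k = 0 := by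
      intro k hk
      have h3 := key k p
      rw [h1, h2, hk, mul_div_cancel₀ _ (hlam k)] at h3
      apply mul_left_cancel₀ hD0
      linear_combination h3
    exact no_triple C p (he p (mem_kln.mpr h2)) (mem_kln.mpr h2) (mem_kln.mpr (on g rfl))
      (mem_kln.mpr (on h hgh)) g.2.2.symm h.2.2.symm (fun h' => hne (Subtype.ext h'))
  have P4 : (∏ g : ι, lam g / mu g) * ∏ g : ι, (-nu g) / lam g = ∏ g : ι, (-nu g) / mu g := by
    rw [← prod_mul_distrib]
    refine prod_congr rfl fun g _ => ?_
    have := hlam g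
    have := hmu g
    field_simp
  rw [P1, P2, P3] at P4
  have h2 : ringChar F ≠ 2 := by
    intro h
    have := FiniteField.even_card_of_char_two h
    rcases hodd with ⟨k, hk⟩
    omega
  exact Ring.neg_one_ne_one_of_char_ne_two h2 (by linear_combination -P4)

/-- Jamison's bound on affine blocking sets. -/
theorem jamison (B : Finset (F × F))
    (hB : ∀ d c, ∃ p ∈ B, p ∈ kln d c) : 2 * Fintype.card F - 1 ≤ B.card := by
  obtain ⟨o, ho, -⟩ := hB none 0
  by_contra hlt
  push Not at hlt
  let f : MvPolynomial (Fin 2) F := ∏ p ∈ B.erase o,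
    (1 - MvPolynomial.C (p.1 - o.1) * MvPolynomial.X 0
      - MvPolynomial.C (p.2 - o.2) * MvPolynomial.X 1)
  have hdeg : f.totalDegree ≤ (B.erase o).card := by
    refine (MvPolynomial.totalDegree_finsetProd _ _).trans ?_
    rw [card_eq_sum_ones]
    refine sum_le_sum fun p _ => ?_
    have hX : ∀ (a : F) (i : Fin 2), (MvPolynomial.C a * MvPolynomial.X i).totalDegree ≤ 1 := by
      intro a i
      refine (MvPolynomial.totalDegree_mul _ _).trans ?_
      simp
    refine (MvPolynomial.totalDegree_sub _ _).trans (max_le ?_ (hX _ _))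
    refine (MvPolynomial.totalDegree_sub _ _).trans (max_le ?_ (hX _ _))
    simp
  have hz := MvPolynomial.sum_eval_eq_zero f (by
    rw [card_erase_of_mem ho] at hdeg
    have h1 := Fintype.one_lt_card (α := F)
    have : 0 < B.card := card_pos.mpr ⟨o, ho⟩
    rw [Fintype.card_fin]
    omega)
  rw [Fintype.sum_eq_single 0] at hz
  · simp [f, MvPolynomial.eval_prod] at hz
  · intro x hx
    have hx' : ¬ (x 0 = 0 ∧ x 1 = 0) := by
      rintro ⟨h0, h1⟩
      apply hx
      ext i
      fin_cases i <;> simpa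
    obtain ⟨d, s, hs, h0, h1⟩ := exists_kdir _ _ hx'
    obtain ⟨p, hp, hpl⟩ := hB d (-(kA d * o.1 + kB d * o.2) - s⁻¹)
    rw [mem_kln] at hpl
    have hmain : 1 - (p.1 - o.1) * x 0 - (p.2 - o.2) * x 1 = 0 := by
      rw [h0, h1]
      linear_combination -s * hpl - mul_inv_cancel₀ hs
    have hpo : p ≠ o := by
      rintro rfl
      simp at hmain
    simp only [f, MvPolynomial.eval_prod]
    refine prod_eq_zero (mem_erase.mpr ⟨hpo, hp⟩) ?_
    simpa using hmain

theorem odd_points (hodd : Odd (Fintype.card F)) (C : Option F → F) :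
    2 * Fintype.card F ≤ (univ.filter fun p => Odd (kmul C p)).card + 2 := by
  set O := univ.filter fun p => Odd (kmul C p) with hO
  obtain ⟨o, ho⟩ : ∃ o : F × F, ∀ d, (∃ p ∈ insert o O, p ∈ kln d (C d)) := by
    by_cases h : ∃ d, ∀ p ∈ kln d (C d), Even (kmul C p)
    · obtain ⟨d, hd⟩ := h
      have hne : (kln d (C d)).Nonempty := by
        rw [← card_pos, card_kln]; exact Fintype.card_pos
      obtain ⟨o, ho⟩ := hne
      refine ⟨o, fun e => ?_⟩
      by_cases hde : d = e
      · subst hde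
        exact ⟨o, mem_insert_self _ _, ho⟩
      · by_contra hcon
        push Not at hcon
        apply hde
        apply nucleus_unique hodd C (kmul_eq_two C d hd) (kmul_eq_two C e ?_)
        intro p hp
        by_contra hp'
        exact hcon p (mem_insert_of_mem (by simpa [hO] using hp')) hp
    · push Not at h
      refine ⟨0, fun d => ?_⟩
      obtain ⟨p, hp, hp'⟩ := h d
      exact ⟨p, mem_insert_of_mem (by simpa [hO] using hp'), hp⟩
  have hJ := jamison (insert o O) (by
    intro d c
    by_cases hc : c = C d
    · rw [hc]; exact ho d
    · by_contra hcon
      push Not at hcon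
      have h1 := sum_kmul_other C d hc
      have h2 : Even (∑ p ∈ kln d c, kmul C p) := by
        refine even_sum _ fun p hp => ?_
        by_contra hp'
        exact hcon p (mem_insert_of_mem (by simpa [hO] using hp')) hp
      rw [h1] at h2
      exact (Nat.not_even_iff_odd.mpr hodd) h2)
  have := card_insert_le o O
  omega

theorem kakeya_main (hodd : Odd (Fintype.card F)) (C : Option F → F) :
    2 * (Fintype.card F * (Fintype.card F + 1)) + 2 * Fintype.card F ≤
      4 * (univ.filter fun p => ∃ d, p ∈ kln d (C d)).card + 2 := by
  have h1 := odd_points hodd C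
  have h2 := sum_kmul_univ C
  have h3 := sum_kmul_sq C
  have h4 : ∀ p, (if Odd (kmul C p) then 1 else 0) + 4 * kmul C p ≤
      4 * (if ∃ d, p ∈ kln d (C d) then 1 else 0) + kmul C p * kmul C p := by
    intro p
    by_cases h : ∃ d, p ∈ kln d (C d)
    · rw [if_pos h]
      generalize kmul C p = m
      by_cases hm : 4 ≤ m
      · split_ifs with ho
        · have : m ≠ 4 := by rintro rfl; exact absurd ho (by decide)
          have : 5 ≤ m := by omega
          nlinarith
        · nlinarith
      · have : m < 4 := by omega
        interval_cases m <;> simp <;> decide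
    · have : kmul C p = 0 := by
        rw [kmul, card_eq_zero, filter_eq_empty_iff]
        exact fun d _ hd => h ⟨d, hd⟩
      simp [this]
  have h5 := sum_le_sum (s := univ) fun p _ => h4 p
  rw [sum_add_distrib, sum_add_distrib, ← mul_sum, ← mul_sum, ← card_filter, ← card_filter,
    h2, h3] at h5
  linarith

theorem exists_kconst {d : Option F} {L : Set (F × F)} (h : IsLineWithDir d L) :
    ∃ c, ∀ p, p ∈ L ↔ p ∈ kln d c := by
  rcases d with _ | m
  · obtain ⟨c, rfl⟩ := h
    refine ⟨-c, fun p => ?_⟩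
    simp only [Set.mem_setOf_eq, mem_kln, kA, kB]
    constructor
    · intro h; linear_combination h
    · intro h; linear_combination h
  · obtain ⟨c, rfl⟩ := h
    refine ⟨c, fun p => ?_⟩
    simp only [Set.mem_setOf_eq, mem_kln, kA, kB]
    constructor
    · intro h; linear_combination -h
    · intro h; linear_combination -h

end KakeyaHelpers

/-- **Cooper.** For `q` an odd prime power, every Kakeya set `K` in `AG(2,q)`
satisfies `|K| ≥ q(q+1)/2 + 5q/14 - 1/14`, i.e. `14|K| ≥ 7q(q+1) + 5q - 1`. -/
theorem kakeya_cooper_bound {F : Type*} [Field F] [Fintype F] (q : ℕ)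
    (hq : Fintype.card F = q) (hodd : Odd q)
    (L : Option F → Set (F × F)) (hL : ∀ d, IsLineWithDir d (L d))
    (K : Set (F × F)) (hK : K = ⋃ d, L d) :
    7 * q * (q + 1) + 5 * q - 1 ≤ 14 * K.ncard := by
  classical
  subst hq
  choose C hC using fun d => exists_kconst (hL d)
  have h := kakeya_main hodd C
  have hKc : K.ncard = (Finset.univ.filter fun p => ∃ d, p ∈ kln d (C d)).card := by
    rw [← Set.ncard_coe_finset, hK]
    congr 1
    ext p
    simp [hC]
  replace h : 2 * (Fintype.card F * (Fintype.card F + 1)) + 2 * Fintype.card F ≤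
      4 * K.ncard + 2 := by
    rw [hKc]
    convert h
  have h1 := Fintype.one_lt_card (α := F)
  obtain ⟨k, hk⟩ := hodd
  have h3 : 3 ≤ Fintype.card F := by omega
  rw [mul_assoc]
  omega
end

section
/- Let q be an odd prime power. Every Kakeya set K in AG(2,q) satisfies |K| ≥ q(q+1)/2 + (q−1)/2, i.e., 2·|K| ≥ q(q+1) + (q−1). -/
open Finset in
theorem kk_prod_erase {F : Type*} [Field F] [Fintype F] [DecidableEq F] :
    ∏ x ∈ (univ : Finset F).erase 0, x = -1 := by
  rw [← Units.val_one, ← Units.val_neg, ← FiniteField.prod_univ_units_id_eq_neg_one (K := F),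
    Units.coe_prod]
  symm
  refine Finset.prod_bij (fun u _ => (u : F)) (by simp) ?_ ?_ (by simp)
  · intro u _ v _ h
    exact Units.ext h
  · intro y hy
    exact ⟨Units.mk0 y (by simpa using hy), by simp⟩

open Finset in
theorem kk_prod_bij {F : Type*} [Field F] [Fintype F] [DecidableEq F] (h : F → F)
    (hs : Function.Surjective h) (i : F) :
    ∏ m ∈ univ.erase i, (h m - h i) = -1 := by
  have hb : Function.Injective h := Finite.injective_iff_surjective.2 hs
  rw [← kk_prod_erase (F := F)]
  refine Finset.prod_bij (fun m _ => h m - h i) ?_ ?_ ?_ ?_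
  · intro m hm
    simp only [mem_erase, mem_univ, and_true] at hm ⊢
    exact fun h0 => hm (hb (sub_eq_zero.1 h0))
  · intro m _ n _ hmn
    exact hb (by simpa using hmn)
  · intro y hy
    obtain ⟨m, hm⟩ := hs (y + h i)
    refine ⟨m, ?_, by simp [hm]⟩
    simp only [mem_erase, mem_univ, and_true] at hy ⊢
    rintro rfl
    apply hy
    simpa using hm
  · intros; rfl

open Finset in
theorem kk_slope_surj {F : Type*} [Field F] [DecidableEq F] (b : F → F) (c a : F)
    (H : ∀ x, x = c ∨ ∃ m, m ≠ a ∧ a * x + b a = m * x + b m) :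
    Function.Surjective (fun m => if m = a then c else -(b m - b a) / (m - a)) := by
  intro x
  rcases H x with h | ⟨m, hm, h⟩
  · exact ⟨a, by simp [h]⟩
  · refine ⟨m, ?_⟩
    have : m - a ≠ 0 := sub_ne_zero.2 hm
    simp only [hm, if_false]
    rw [div_eq_iff this]
    linear_combination h

open Finset in
theorem kk_nuclei_vert {F : Type*} [Field F] [Fintype F] [DecidableEq F] (h2 : (2 : F) ≠ 0)
    (b : F → F) (c a : F)
    (H : ∀ x, x = c ∨ ∃ m, m ≠ a ∧ a * x + b a = m * x + b m)
    (H' : ∀ y, ∃ m, y = m * c + b m) : False := by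
  have h1 := kk_prod_bij _ (kk_slope_surj b c a H) a
  have h3 := kk_prod_bij (fun m : F => m) Function.surjective_id a
  have h4 := kk_prod_bij (fun m : F => -(m * c + b m)) (fun y => by
    obtain ⟨m, hm⟩ := H' (-y)
    exact ⟨m, by simp [← hm]⟩) a
  have h5 : (∏ m ∈ univ.erase a, ((if m = a then c else -(b m - b a) / (m - a))
      - (if a = a then c else -(b a - b a) / (a - a)))) * ∏ m ∈ univ.erase a, (m - a)
      = ∏ m ∈ univ.erase a, (-(m * c + b m) - -(a * c + b a)) := by
    rw [← Finset.prod_mul_distrib]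
    refine Finset.prod_congr rfl fun m hm => ?_
    have hm' : m ≠ a := by simpa using hm
    have : m - a ≠ 0 := sub_ne_zero.2 hm'
    simp only [hm', if_false, if_true]
    field_simp
    ring
  rw [h1, h3, h4] at h5
  exact h2 (by linear_combination h5)

open Finset in
theorem kk_slope_prod {F : Type*} [Field F] [Fintype F] [DecidableEq F]
    (b : F → F) (c a a' x0 y0 : F) (haa : a ≠ a') (hx : y0 = a * x0 + b a)
    (hx' : y0 = a' * x0 + b a')
    (H : ∀ x, x = c ∨ ∃ m, m ≠ a ∧ a * x + b a = m * x + b m) :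
    (c - x0) * (a' - a) * ∏ m ∈ (univ.erase a).erase a', (-(b m + m * x0 - y0)) = 1 := by
  have h1 := kk_prod_bij _ (kk_slope_surj b c a H) a'
  have h3 := kk_prod_bij (fun m : F => m) Function.surjective_id a
  have haa' : a' - a ≠ 0 := sub_ne_zero.2 haa.symm
  rw [← Finset.mul_prod_erase (univ.erase a') _ (a := a) (by simp [haa])] at h1
  rw [← Finset.mul_prod_erase (univ.erase a) _ (a := a') (by simp [haa.symm])] at h3
  rw [Finset.erase_right_comm] at h1
  have hx0 : -(b a' - b a) / (a' - a) = x0 := by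
    rw [div_eq_iff haa']; linear_combination hx' - hx
  simp only [haa.symm, if_true, if_false, hx0] at h1
  have h5 : (∏ m ∈ (univ.erase a).erase a', ((if m = a then c else -(b m - b a) / (m - a)) - x0))
      * ∏ m ∈ (univ.erase a).erase a', (m - a)
      = ∏ m ∈ (univ.erase a).erase a', (-(b m + m * x0 - y0)) := by
    rw [← Finset.prod_mul_distrib]
    refine Finset.prod_congr rfl fun m hm => ?_
    have hm' : m ≠ a := by
      simp only [mem_erase] at hm
      exact hm.2.1
    have : m - a ≠ 0 := sub_ne_zero.2 hm'
    simp only [hm', if_false]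
    rw [sub_mul, div_mul_cancel₀ _ this, hx]
    ring
  rw [← h5]
  calc _ = ((c - x0) * ∏ m ∈ (univ.erase a).erase a',
          ((if m = a then c else -(b m - b a) / (m - a)) - x0)) *
          ((a' - a) * ∏ m ∈ (univ.erase a).erase a', (m - a)) := by ring
    _ = 1 := by rw [h1, h3]; ring

open Finset in
theorem kk_nuclei_slopes {F : Type*} [Field F] [Fintype F] [DecidableEq F] (h2 : (2 : F) ≠ 0)
    (b : F → F) (c a a' : F) (haa : a ≠ a')
    (H : ∀ x, x = c ∨ ∃ m, m ≠ a ∧ a * x + b a = m * x + b m)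
    (H' : ∀ x, x = c ∨ ∃ m, m ≠ a' ∧ a' * x + b a' = m * x + b m) : False := by
  have hn : a' - a ≠ 0 := sub_ne_zero.2 haa.symm
  have hxy : a * (-(b a' - b a) / (a' - a)) + b a = a' * (-(b a' - b a) / (a' - a)) + b a' := by
    field_simp
    ring
  have e1 := kk_slope_prod b c a a' _ _ haa rfl hxy H
  have e2 := kk_slope_prod b c a' a _ _ haa.symm hxy rfl H'
  rw [Finset.erase_right_comm] at e2
  exact h2 (by linear_combination -e1 - e2)

theorem kk_nuclei {F : Type*} [Field F] [Fintype F] (h2 : (2 : F) ≠ 0)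
    (L : Option F → Set (F × F)) (hL : ∀ d, IsLineWithDir d (L d)) (d d' : Option F)
    (hd : d ≠ d') (H : ∀ p ∈ L d, ∃ e, e ≠ d ∧ p ∈ L e)
    (H' : ∀ p ∈ L d', ∃ e, e ≠ d' ∧ p ∈ L e) : False := by
  classical
  obtain ⟨c, hc⟩ : ∃ c : F, L none = {p : F × F | p.1 = c} := hL none
  have hb : ∀ m : F, ∃ b : F, L (some m) = {p : F × F | p.2 = m * p.1 + b} := fun m => hL (some m)
  choose b hb using hb
  have S : ∀ a, (∀ p ∈ L (some a), ∃ e, e ≠ some a ∧ p ∈ L e) →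
      ∀ x, x = c ∨ ∃ m, m ≠ a ∧ a * x + b a = m * x + b m := by
    intro a ha x
    obtain ⟨e, he, hp⟩ := ha (x, a * x + b a) (by simp [hb])
    cases e with
    | none => left; simpa [hc] using hp
    | some m => right; exact ⟨m, by simpa using he, by simpa [hb] using hp⟩
  have V : (∀ p ∈ L none, ∃ e, e ≠ none ∧ p ∈ L e) → ∀ y, ∃ m, y = m * c + b m := by
    intro ha y
    obtain ⟨e, he, hp⟩ := ha (c, y) (by simp [hc])
    cases e with
    | none => exact absurd rfl he
    | some m => exact ⟨m, by simpa [hb] using hp⟩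
  cases d with
  | none => cases d' with
    | none => exact hd rfl
    | some a => exact kk_nuclei_vert h2 b c a (S a H') (V H)
  | some a => cases d' with
    | none => exact kk_nuclei_vert h2 b c a (S a H) (V H')
    | some a' => exact kk_nuclei_slopes h2 b c a a' (by simpa using hd) (S a H) (S a' H')

theorem kk_inter {F : Type*} [Field F] (d d' : Option F) (hd : d ≠ d') (A B : Set (F × F))
    (hA : IsLineWithDir d A) (hB : IsLineWithDir d' B) :
    ∃ p, ∀ x, (x ∈ A ∧ x ∈ B) ↔ x = p := by
  cases d with
  | none => cases d' with
    | none => exact absurd rfl hd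
    | some a =>
      obtain ⟨c, rfl⟩ := hA
      obtain ⟨b, rfl⟩ := hB
      refine ⟨(c, a * c + b), ?_⟩
      rintro ⟨x, y⟩
      simp only [Set.mem_setOf_eq, Prod.mk.injEq]
      constructor
      · rintro ⟨rfl, h⟩; exact ⟨rfl, h⟩
      · rintro ⟨rfl, h⟩; exact ⟨rfl, h⟩
  | some a => cases d' with
    | none =>
      obtain ⟨b, rfl⟩ := hA
      obtain ⟨c, rfl⟩ := hB
      refine ⟨(c, a * c + b), ?_⟩
      rintro ⟨x, y⟩
      simp only [Set.mem_setOf_eq, Prod.mk.injEq]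
      constructor
      · rintro ⟨h, rfl⟩; exact ⟨rfl, h⟩
      · rintro ⟨rfl, h⟩; exact ⟨h, rfl⟩
    | some a' =>
      obtain ⟨b, rfl⟩ := hA
      obtain ⟨b', rfl⟩ := hB
      have hn : a - a' ≠ 0 := sub_ne_zero.2 (by simpa using hd)
      refine ⟨((b' - b) / (a - a'), a * ((b' - b) / (a - a')) + b), ?_⟩
      rintro ⟨x, y⟩
      simp only [Set.mem_setOf_eq, Prod.mk.injEq]
      constructor
      · rintro ⟨h, h'⟩
        have : x = (b' - b) / (a - a') := by
          rw [eq_div_iff hn]; linear_combination h' - h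
        exact ⟨this, by rw [h, this]⟩
      · rintro ⟨rfl, rfl⟩
        refine ⟨rfl, ?_⟩
        field_simp
        ring

open Finset in
theorem kk_line_card {F : Type*} [Field F] [Fintype F] (d : Option F) (A : Set (F × F))
    [DecidablePred (· ∈ A)] (hA : IsLineWithDir d A) :
    (univ.filter (· ∈ A)).card = Fintype.card F := by
  rw [← Finset.card_univ]
  symm
  cases d with
  | none =>
    obtain ⟨c, rfl⟩ := hA
    refine Finset.card_bij (fun y _ => (c, y)) (by simp) (by simp) ?_
    rintro ⟨x, y⟩ h
    simp at h
    simp [h]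
  | some a =>
    obtain ⟨b, rfl⟩ := hA
    refine Finset.card_bij (fun x _ => (x, a * x + b)) (by simp) (by simp) ?_
    rintro ⟨x, y⟩ h
    simp at h
    simp [h]

theorem kk_line_of {F : Type*} [Field F] (u v : F) (P : F × F) (h : u ≠ 0 ∨ v ≠ 0) :
    ∃ d, IsLineWithDir d {p : F × F | u * (p.1 - P.1) + v * (p.2 - P.2) = 1} := by
  by_cases hv : v = 0
  · have hu : u ≠ 0 := by tauto
    refine ⟨none, P.1 + u⁻¹, ?_⟩
    ext p
    simp only [hv, Set.mem_setOf_eq]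
    constructor
    · intro h
      field_simp
      linear_combination h
    · intro h
      rw [h]
      field_simp
      ring
  · refine ⟨some (-u / v), P.2 + (1 + u * P.1) / v, ?_⟩
    ext p
    simp only [Set.mem_setOf_eq]
    constructor
    · intro h
      field_simp
      linear_combination h
    · intro h
      rw [h]
      field_simp
      ring

open Finset in
theorem kk_jamison {F : Type*} [Field F] [Fintype F] (O : Finset (F × F)) (P : F × F)
    (H : ∀ u v : F, (u ≠ 0 ∨ v ≠ 0) → ∃ p ∈ O, u * (p.1 - P.1) + v * (p.2 - P.2) = 1) :
    2 * (Fintype.card F - 1) ≤ O.card := by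
  classical
  by_contra hlt
  push Not at hlt
  let g : F × F → MvPolynomial (Fin 2) F := fun p =>
    1 - (MvPolynomial.C (p.1 - P.1) * MvPolynomial.X 0 + MvPolynomial.C (p.2 - P.2) * MvPolynomial.X 1)
  have hg : ∀ p, (g p).totalDegree ≤ 1 := by
    intro p
    refine (MvPolynomial.totalDegree_sub _ _).trans (max_le (by simp) ?_)
    refine (MvPolynomial.totalDegree_add _ _).trans (max_le ?_ ?_)
    · refine (MvPolynomial.totalDegree_mul _ _).trans (by rw [MvPolynomial.totalDegree_C]; simp)
    · refine (MvPolynomial.totalDegree_mul _ _).trans (by rw [MvPolynomial.totalDegree_C]; simp)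
  have hdeg : (∏ p ∈ O, g p).totalDegree < (Fintype.card F - 1) * Fintype.card (Fin 2) := by
    calc _ ≤ ∑ p ∈ O, (g p).totalDegree := MvPolynomial.totalDegree_finsetProd _ _
      _ ≤ ∑ p ∈ O, 1 := Finset.sum_le_sum fun p _ => hg p
      _ = O.card := by simp
      _ < _ := by rw [Fintype.card_fin]; omega
  have h0 := MvPolynomial.sum_eval_eq_zero _ hdeg
  rw [Finset.sum_eq_single (0 : Fin 2 → F)] at h0
  · simp [g, map_prod] at h0
  · intro w _ hw
    have hw' : w 0 ≠ 0 ∨ w 1 ≠ 0 := by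
      by_contra hc
      push Not at hc
      apply hw
      ext i
      fin_cases i
      · exact hc.1
      · exact hc.2
    obtain ⟨p, hp, hp1⟩ := H _ _ hw'
    rw [map_prod]
    refine Finset.prod_eq_zero hp ?_
    simp only [g, map_sub, map_one, map_add, map_mul, MvPolynomial.eval_C, MvPolynomial.eval_X]
    linear_combination -hp1
  · simp

theorem kk_pointwise (m : ℕ) :
    4 * (m : ℤ) - (m : ℤ) ^ 2 + (if Odd m then 1 else 0) ≤ 4 * (if 0 < m then 1 else 0) := by
  rcases Nat.eq_zero_or_pos m with rfl | hm
  · simp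
  · rw [if_pos hm]
    split_ifs with h
    · obtain ⟨k, rfl⟩ := h
      push_cast
      have : (0 : ℤ) ≤ k * (k - 1) := by
        rcases Nat.eq_zero_or_pos k with rfl | hk
        · simp
        · exact mul_nonneg (by positivity) (by omega)
      nlinarith
    · nlinarith [sq_nonneg ((m : ℤ) - 2)]

open Finset in
/-- **Blokhuis–Mazzocca.** For `q` an odd prime power, every Kakeya set `K` in
`AG(2,q)` satisfies `|K| ≥ q(q+1)/2 + (q-1)/2`, i.e. `2|K| ≥ q(q+1) + (q-1)`. -/
theorem kakeya_sharp_lower_bound {F : Type*} [Field F] [Fintype F] (q : ℕ)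
    (hq : Fintype.card F = q) (hodd : Odd q)
    (L : Option F → Set (F × F)) (hL : ∀ d, IsLineWithDir d (L d))
    (K : Set (F × F)) (hK : K = ⋃ d, L d) :
    q * (q + 1) + (q - 1) ≤ 2 * K.ncard := by
  classical
  have h2 : (2 : F) ≠ 0 := by
    apply Ring.two_ne_zero
    intro hc
    have := FiniteField.even_card_of_char_two hc
    rw [hq] at this
    obtain ⟨k, hk⟩ := hodd
    omega
  let mu : F × F → ℕ := fun p => (univ.filter (fun d => p ∈ L d)).card
  let O : Finset (F × F) := univ.filter (fun p => Odd (mu p))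
  -- sum of multiplicities over a set
  have hsum : ∀ A : Set (F × F), ∑ p ∈ univ.filter (· ∈ A), mu p
      = ∑ d, (univ.filter (fun p => p ∈ A ∧ p ∈ L d)).card := by
    intro A
    simp only [mu, Finset.card_filter]
    rw [Finset.sum_comm]
    refine Finset.sum_congr rfl fun d _ => ?_
    rw [Finset.sum_filter]
    refine Finset.sum_congr rfl fun p _ => ?_
    by_cases hp : p ∈ A <;> simp [hp]
  have hinter : ∀ (d d' : Option F) (A : Set (F × F)), d' ≠ d → IsLineWithDir d A →
      (univ.filter (fun p => p ∈ A ∧ p ∈ L d')).card = 1 := by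
    intro d d' A hd hA
    obtain ⟨p, hp⟩ := kk_inter d d' hd.symm A (L d') hA (hL d')
    rw [Finset.card_eq_one]
    exact ⟨p, by ext x; simp [hp]⟩
  have hlines : ∀ (d : Option F) (A : Set (F × F)), IsLineWithDir d A →
      ∑ p ∈ univ.filter (· ∈ A), mu p
        = (univ.filter (fun p => p ∈ A ∧ p ∈ L d)).card + q := by
    intro d A hA
    rw [hsum, ← Finset.add_sum_erase univ _ (Finset.mem_univ d)]
    congr 1
    rw [Finset.sum_congr rfl (fun d' hd' => hinter d d' A (by simpa using hd') hA)]
    simp [hq]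
  have hself : ∀ d, ∑ p ∈ univ.filter (· ∈ L d), mu p = 2 * q := by
    intro d
    rw [hlines d _ (hL d)]
    simp only [and_self]
    rw [kk_line_card d _ (hL d), hq]
    ring
  have hm1 : ∑ p, mu p = (q + 1) * q := by
    have := hsum Set.univ
    simp only [Set.mem_univ, true_and, Finset.filter_true] at this
    rw [this, Finset.sum_congr rfl (fun d _ => kk_line_card d _ (hL d))]
    simp [hq]
  have hm2 : ∑ p, mu p ^ 2 = (q + 1) * (2 * q) := by
    have : ∑ d, ∑ p ∈ univ.filter (· ∈ L d), mu p = (q + 1) * (2 * q) := by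
      rw [Finset.sum_congr rfl (fun d _ => hself d)]
      simp [hq]
    rw [← this]
    simp only [Finset.sum_filter]
    rw [Finset.sum_comm]
    refine Finset.sum_congr rfl fun p _ => ?_
    rw [← Finset.sum_filter, Finset.sum_const, sq, smul_eq_mul]
  -- non-defining lines meet O
  have hother : ∀ (d : Option F) (A : Set (F × F)), IsLineWithDir d A → A ≠ L d →
      ∃ p ∈ A, Odd (mu p) := by
    intro d A hA hne
    by_contra hc
    push Not at hc
    have h0 : (univ.filter (fun p => p ∈ A ∧ p ∈ L d)).card = 0 := by
      rw [Finset.card_eq_zero, Finset.filter_eq_empty_iff]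
      rintro p - ⟨hp, hp'⟩
      apply hne
      have hLd := hL d
      cases d with
      | none =>
        obtain ⟨c, rfl⟩ := hA
        obtain ⟨c', hc'⟩ := hLd
        rw [hc'] at hp' ⊢
        simp only [Set.mem_setOf_eq] at hp hp'
        rw [← hp, ← hp']
      | some m =>
        obtain ⟨c, rfl⟩ := hA
        obtain ⟨c', hc'⟩ := hLd
        rw [hc'] at hp' ⊢
        simp only [Set.mem_setOf_eq] at hp hp'
        have : c = c' := by linear_combination hp' - hp
        rw [this]
    have h1 := hlines d A hA
    rw [h0, zero_add] at h1
    have : Even (∑ p ∈ univ.filter (· ∈ A), mu p) := by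
      refine Finset.even_sum _ fun p hp => ?_
      exact Nat.not_odd_iff_even.1 (hc p (by simpa using hp))
    rw [h1] at this
    exact (Nat.not_even_iff_odd.2 hodd) this
  have hnuc : ∀ d, (∀ p ∈ L d, ¬ Odd (mu p)) → ∀ p ∈ L d, ∃ e, e ≠ d ∧ p ∈ L e := by
    intro d hd p hp
    by_contra hc
    push Not at hc
    apply hd p hp
    have : univ.filter (fun e => p ∈ L e) = {d} := by
      ext e
      simp only [mem_filter, mem_univ, true_and, mem_singleton]
      constructor
      · intro he
        by_contra hne
        exact hc e hne he
      · rintro rfl; exact hp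
    simp [mu, this]
  -- choose P
  have hP : ∃ P : F × F, ∀ d, P ∉ L d → ∃ p ∈ L d, Odd (mu p) := by
    by_cases hex : ∃ d, ∀ p ∈ L d, ¬ Odd (mu p)
    · obtain ⟨d, hd⟩ := hex
      have hne : ∃ P, P ∈ L d := by
        obtain ⟨e, hde⟩ := exists_ne d
        obtain ⟨p, hp⟩ := kk_inter d e hde.symm _ _ (hL d) (hL e)
        exact ⟨p, ((hp p).2 rfl).1⟩
      obtain ⟨P, hPd⟩ := hne
      refine ⟨P, fun e he => ?_⟩
      by_contra hc
      push Not at hc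
      have hde : d ≠ e := by rintro rfl; exact he hPd
      exact kk_nuclei h2 L hL d e hde (hnuc d hd)
        (hnuc e fun p hp => hc p hp)
    · push Not at hex
      exact ⟨0, fun d _ => hex d⟩
  obtain ⟨P, hP⟩ := hP
  have hO : 2 * (q - 1) ≤ O.card := by
    rw [← hq]
    refine kk_jamison O P fun u v huv => ?_
    obtain ⟨d, hd⟩ := kk_line_of u v P huv
    have : ∃ p ∈ {p : F × F | u * (p.1 - P.1) + v * (p.2 - P.2) = 1}, Odd (mu p) := by
      by_cases hA : {p : F × F | u * (p.1 - P.1) + v * (p.2 - P.2) = 1} = L d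
      · rw [hA]
        apply hP
        rw [← hA]
        simp
      · exact hother d _ hd hA
    obtain ⟨p, hp, hp'⟩ := this
    exact ⟨p, by simp [O, hp'], hp⟩
  have hKc : K.ncard = (univ.filter (fun p => 0 < mu p)).card := by
    rw [← Set.ncard_coe_finset]
    congr 1
    ext p
    simp [hK, mu, Finset.card_pos, Finset.Nonempty]
  have hfin := Finset.sum_le_sum (s := (univ : Finset (F × F))) fun p _ => kk_pointwise (mu p)
  rw [Finset.sum_add_distrib, Finset.sum_sub_distrib, ← Finset.mul_sum, ← Finset.mul_sum] at hfin
  have e1 : ∑ p, (mu p : ℤ) = (q + 1) * q := by exact_mod_cast hm1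
  have e2 : ∑ p, (mu p : ℤ) ^ 2 = (q + 1) * (2 * q) := by exact_mod_cast hm2
  have e3 : ∑ p, (if Odd (mu p) then (1 : ℤ) else 0) = (O.card : ℤ) := by
    simp [O]
  have e4 : ∑ p, (if 0 < mu p then (1 : ℤ) else 0) = (K.ncard : ℤ) := by
    rw [hKc]; simp
  rw [e1, e2, e3, e4] at hfin
  have hq1 : 1 ≤ q := hodd.pos
  zify [hq1] at hO ⊢
  nlinarith
end
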